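/- arXiv:2306.09040 — 7 statements merged into one kernel-verified Lean document; each statement's English description precedes it below -/
import Mathlib

section
/- There exists a constant C > 0 such that for every n ≥ 1, every probability vector (p_v)_{v ∈ Fin n}, and every integer k ≥ 1, the following holds: if f : Fin n → Fin n is a random function whose values f(v) are independent and each distributed according to (p_v), then the expected number of vertices x that are endpoints of a directed path of length k (i.e., there exist pairwise distinct vertices v₀, v₁, …, v_k with f(v_i) = v_{i+1} for all 0 ≤ i < k and v_k = x) is at most C·n/k. -/
open scoped BigOperators Classical

/-- `IsPathEndpoint f k x` says that `x` is the endpoint of a directed path of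
length `k` in the functional digraph of `f`: there are pairwise distinct
vertices `v₀, …, v_k` with `f(v_i) = v_{i+1}` for all `i < k` and `v_k = x`. -/
def IsPathEndpoint {V : Type*} (f : V → V) (k : ℕ) (x : V) : Prop :=
  ∃ v : Fin (k + 1) → V, Function.Injective v ∧
    (∀ i : Fin k, f (v i.castSucc) = v i.succ) ∧ v (Fin.last k) = x

/-- The weight of `f` under the law of independent values with distribution `p`. -/
noncomputable def mapWeight {V : Type*} [Fintype V] (p : V → ℝ) (f : V → V) : ℝ :=
  ∏ v, p (f v)

/-- Some `v` reaches `z` after exactly `t` steps, without visiting `x` strictly before. -/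
def ReachedAvoiding {V : Type*} (f : V → V) (x : V) (t : ℕ) (z : V) : Prop :=
  ∃ v, f^[t] v = z ∧ ∀ e < t, f^[e] v ≠ x

/-- The expected number of vertices `x` at which some walk arrives for the first time after
exactly `k` steps. -/
noncomputable def expectedEndpoints {V : Type*} [Fintype V] (p : V → ℝ) (k : ℕ) : ℝ :=
  ∑ f : V → V, mapWeight p f * ∑ x, if ReachedAvoiding f x k x then (1 : ℝ) else 0

/-- The probability that `r` independent samples of `p` are pairwise distinct. -/
noncomputable def distinctProb {V : Type*} [Fintype V] (p : V → ℝ) (r : ℕ) : ℝ :=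
  ∑ w : Fin r → V, if Function.Injective w then ∏ j, p (w j) else 0

section

variable {V : Type*} [Fintype V] {p : V → ℝ}

lemma mapWeight_nonneg (hp : ∀ v, 0 ≤ p v) (f : V → V) : 0 ≤ mapWeight p f :=
  Finset.prod_nonneg fun _ _ => hp _

lemma sum_prod_eq_one {ι : Type*} [Fintype ι] [DecidableEq ι] (h1 : ∑ v, p v = 1) :
    ∑ g : ι → V, ∏ i, p (g i) = 1 := by
  have := (Finset.prod_univ_sum (fun _ : ι => (Finset.univ : Finset V)) (fun _ v => p v)).symm
  simpa [h1] using this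

lemma sum_mapWeight (h1 : ∑ v, p v = 1) : ∑ f : V → V, mapWeight p f = 1 :=
  sum_prod_eq_one h1

lemma sum_prod_mul_apply {ι : Type*} [Fintype ι] [DecidableEq ι] (h1 : ∑ v, p v = 1) (j : ι)
    (g : V → ℝ) : ∑ w : ι → V, (∏ i, p (w i)) * g (w j) = ∑ v, p v * g v := by
  have := (Finset.prod_univ_sum (fun _ : ι => (Finset.univ : Finset V))
    (fun i v => p v * if i = j then g v else 1))
  simp only [Finset.prod_mul_distrib, Fintype.piFinset_univ, Finset.prod_ite_eq',
    Finset.mem_univ, if_true] at this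
  rw [← this, Finset.prod_eq_single j]
  · simp
  · intro b _ hb
    simp [hb, h1]
  · simp

lemma mapWeight_extend_mul {ι : Type*} [Fintype ι] (w : ι → V)
    (hw : Function.Injective w) (τ : ι → V) (f : V → V) :
    mapWeight p (Function.extend w τ f) * ∏ j, p (f (w j)) =
      mapWeight p f * ∏ j, p (τ j) := by
  have key : ∀ g : V → V, mapWeight p g = (∏ j, p (g (w j))) *
      ∏ v ∈ (Finset.univ.image w)ᶜ, p (g v) := by
    intro g
    unfold mapWeight
    rw [← Finset.prod_mul_prod_compl (Finset.univ.image w), Finset.prod_image hw.injOn]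
  rw [key, key f]
  have h2 : ∏ v ∈ (Finset.univ.image w)ᶜ, p (Function.extend w τ f v)
      = ∏ v ∈ (Finset.univ.image w)ᶜ, p (f v) := by
    refine Finset.prod_congr rfl fun v hv => ?_
    rw [Function.extend_apply']
    simpa using hv
  rw [h2]
  simp only [hw.extend_apply]
  ring

lemma sum_mapWeight_prescribed {ι : Type*} [Fintype ι] [DecidableEq ι]
    (h1 : ∑ v, p v = 1) (w : ι → V) (hw : Function.Injective w) (τ : ι → V) (G : (V → V) → ℝ)
    [∀ f : V → V, Decidable (∀ j, f (w j) = τ j)] :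
    ∑ f : V → V, mapWeight p f * (if ∀ j, f (w j) = τ j then G f else 0) =
      (∏ j, p (τ j)) * ∑ f : V → V, mapWeight p f * G (Function.extend w τ f) := by
  have hL : ∑ f : V → V, mapWeight p f * (if ∀ j, f (w j) = τ j then G f else 0) =
      ∑ x ∈ (Finset.univ.filter fun f : V → V => ∀ j, f (w j) = τ j) ×ˢ
        (Finset.univ : Finset (ι → V)), mapWeight p x.1 * G x.1 * ∏ i, p (x.2 i) := by
    rw [Finset.sum_product]
    simp only [← Finset.mul_sum, sum_prod_eq_one h1, mul_one, Finset.sum_filter, mul_ite, mul_zero]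
  rw [hL, Finset.mul_sum]
  symm
  refine Finset.sum_nbij' (fun f => (Function.extend w τ f, f ∘ w))
    (fun x => Function.extend w x.2 x.1) ?_ ?_ ?_ ?_ ?_
  · intro f _
    simp [hw.extend_apply]
  · simp
  · intro f _
    funext v
    by_cases h : ∃ j, w j = v
    · obtain ⟨j, rfl⟩ := h
      simp [hw.extend_apply]
    · simp [Function.extend_apply' _ _ _ h]
  · rintro ⟨f, g⟩ hf
    simp only [Finset.mem_product, Finset.mem_filter, Finset.mem_univ, true_and, and_true] at hf
    ext v
    · by_cases h : ∃ j, w j = v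
      · obtain ⟨j, rfl⟩ := h
        simp [hw.extend_apply, hf]
      · simp [Function.extend_apply' _ _ _ h]
    · simp [hw.extend_apply]
  · intro f _
    have := mapWeight_extend_mul (p := p) w hw τ f
    simp only [Function.comp]
    linear_combination (-G (Function.extend w τ f)) * this

/-! ### Pairwise distinct samples -/

omit [Fintype V] in
lemma snoc_injective_iff {r : ℕ} (w : Fin r → V) (y : V) :
    Function.Injective (Fin.snoc w y : Fin (r + 1) → V) ↔
      Function.Injective w ∧ ∀ j, w j ≠ y := by
  rw [Fin.snoc_injective_iff]
  simp [Set.mem_range]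

lemma sum_fin_succ_eq_sum_snoc {r : ℕ} (F : (Fin (r + 1) → V) → ℝ) :
    ∑ w, F w = ∑ w : Fin r → V, ∑ y, F (Fin.snoc w y) := by
  rw [← Fintype.sum_prod_type_right', ← (Fin.snocEquiv (fun _ : Fin (r+1) => V)).sum_comp]
  rfl

lemma distinctProb_sub_succ (h1 : ∑ v, p v = 1) (r : ℕ) :
    distinctProb p r - distinctProb p (r + 1) =
      ∑ w : Fin r → V, if Function.Injective w then (∏ j, p (w j)) * ∑ j, p (w j) else 0 := by
  unfold distinctProb
  rw [sum_fin_succ_eq_sum_snoc, ← Finset.sum_sub_distrib]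
  refine Finset.sum_congr rfl fun w _ => ?_
  by_cases hw : Function.Injective w
  · simp only [snoc_injective_iff, hw, true_and, if_true, Fin.prod_univ_castSucc,
      Fin.snoc_castSucc, Fin.snoc_last]
    rw [← Finset.sum_filter, ← Finset.mul_sum]
    have h2 := Finset.sum_add_sum_compl (Finset.univ.image w) p
    rw [h1, Finset.sum_image hw.injOn] at h2
    have h3 : (Finset.univ.image w)ᶜ = Finset.univ.filter (fun y => ∀ j, w j ≠ y) := by
      ext y; simp
    rw [h3] at h2
    linear_combination (-∏ j, p (w j)) * h2
  · simp [snoc_injective_iff, hw]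

lemma distinctProb_antitone (hp : ∀ v, 0 ≤ p v) (h1 : ∑ v, p v = 1) :
    Antitone (distinctProb p) := by
  refine antitone_nat_of_succ_le fun r => ?_
  rw [← sub_nonneg, distinctProb_sub_succ h1]
  refine Finset.sum_nonneg fun w _ => ?_
  split_ifs
  · exact mul_nonneg (Finset.prod_nonneg fun _ _ => hp _) (Finset.sum_nonneg fun _ _ => hp _)
  · rfl

/-- The number of entries of `a` of probability less than `c`. -/
noncomputable def lightCount {r : ℕ} (p : V → ℝ) (c : ℝ) (a : Fin r → V) : ℝ :=
  ∑ j, if p (a j) < c then (1 : ℝ) else 0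

omit [Fintype V] in
lemma lightCount_nonneg {r : ℕ} (c : ℝ) (a : Fin r → V) : 0 ≤ lightCount p c a :=
  Finset.sum_nonneg fun _ _ => by split_ifs <;> norm_num

omit [Fintype V] in
lemma mul_sub_lightCount_le (hp : ∀ v, 0 ≤ p v) {r : ℕ} (c : ℝ)
    (a : Fin r → V) : c * (r - lightCount p c a) ≤ ∑ j, p (a j) := by
  have : c * (r - lightCount p c a) = ∑ j, c * (1 - if p (a j) < c then (1 : ℝ) else 0) := by
    rw [← Finset.mul_sum, Finset.sum_sub_distrib]
    simp [lightCount]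
  rw [this]
  refine Finset.sum_le_sum fun j _ => ?_
  split_ifs with h
  · simpa using hp _
  · simpa using h

lemma sum_prod_mul_lightCount_le (h1 : ∑ v, p v = 1) {c : ℝ}
    (hc : 0 ≤ c) (r : ℕ) :
    ∑ w : Fin r → V, (∏ j, p (w j)) * lightCount p c w ≤ r * (c * Fintype.card V) := by
  unfold lightCount
  simp only [Finset.mul_sum]
  rw [Finset.sum_comm]
  have : ∀ j : Fin r, ∑ w : Fin r → V, (∏ i, p (w i)) * (if p (w j) < c then (1 : ℝ) else 0) ≤
      c * Fintype.card V := by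
    intro j
    rw [sum_prod_mul_apply h1 j (fun v => if p v < c then (1 : ℝ) else 0)]
    calc _ ≤ ∑ _v : V, c := Finset.sum_le_sum fun v _ => by
            split_ifs with h
            · simpa using h.le
            · simpa using hc
      _ = _ := by simp [mul_comm]
  calc _ ≤ ∑ _j : Fin r, c * (Fintype.card V : ℝ) := Finset.sum_le_sum fun j _ => this j
    _ = _ := by simp

lemma le_distinctProb_sub_succ (hp : ∀ v, 0 ≤ p v) (h1 : ∑ v, p v = 1) {c : ℝ}
    (hc : 0 ≤ c) (r : ℕ) :
    c * (r * (distinctProb p r - c * Fintype.card V)) ≤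
      distinctProb p r - distinctProb p (r + 1) := by
  rw [distinctProb_sub_succ h1]
  have h2 := sum_prod_mul_lightCount_le h1 hc r
  calc _ ≤ c * (r * distinctProb p r -
        ∑ w : Fin r → V, (∏ j, p (w j)) * lightCount p c w) := by
        gcongr; linarith
    _ = ∑ w : Fin r → V, c * (r * (if Function.Injective w then ∏ j, p (w j) else 0) -
          (∏ j, p (w j)) * lightCount p c w) := by
        rw [← Finset.mul_sum, Finset.sum_sub_distrib, ← Finset.mul_sum, distinctProb]
    _ ≤ _ := by
        refine Finset.sum_le_sum fun w _ => ?_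
        have hw : 0 ≤ ∏ j, p (w j) := Finset.prod_nonneg fun _ _ => hp _
        split_ifs with h
        · have := mul_le_mul_of_nonneg_left (mul_sub_lightCount_le hp c w) hw
          linarith
        · have := mul_nonneg hc (mul_nonneg hw (lightCount_nonneg (p := p) c w))
          linarith

lemma distinctProb_zero : distinctProb p 0 = 1 := by
  simp [distinctProb, Function.injective_of_subsingleton]

lemma distinctProb_nonneg (hp : ∀ v, 0 ≤ p v) (r : ℕ) : 0 ≤ distinctProb p r := by
  refine Finset.sum_nonneg fun w _ => ?_
  split_ifs
  exacts [Finset.prod_nonneg fun _ _ => hp _, le_rfl]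

lemma sq_le_of_le_distinctProb (hp : ∀ v, 0 ≤ p v) (h1 : ∑ v, p v = 1)
    (hn : 1 ≤ Fintype.card V) {k : ℕ} (hk : 1 / 8 ≤ distinctProb p k) :
    (k : ℝ) ^ 2 ≤ 1024 * Fintype.card V := by
  set n : ℝ := (Fintype.card V : ℝ) with hn_def
  have hn0 : (1 : ℝ) ≤ n := Nat.one_le_cast.mpr hn
  have key : ∀ j ≤ k, (j : ℝ) * (j - 1) / (512 * n) ≤ 1 - distinctProb p j := by
    intro j
    induction j with
    | zero => intro _; simp [distinctProb_zero]
    | succ j ih =>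
      intro hj
      have h2 := ih (by lia)
      have h3 := le_distinctProb_sub_succ hp h1 (c := 1 / (16 * n)) (by positivity) j
      have h4 : 1 / 8 ≤ distinctProb p j := hk.trans (distinctProb_antitone hp h1 (by lia))
      have h5 : 1 / (16 * n) * n = 1 / 16 := by field_simp
      rw [← hn_def, h5] at h3
      have h6 : 1 / (16 * n) * (j * (1 / 16)) ≤
          1 / (16 * n) * (j * (distinctProb p j - 1 / 16)) := by
        gcongr; linarith
      have h7 : ((j + 1 : ℕ) : ℝ) * ((j + 1 : ℕ) - 1) / (512 * n) =
          (j : ℝ) * (j - 1) / (512 * n) + 1 / (16 * n) * (j * (1 / 16)) := by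
        push_cast; field_simp; ring
      rw [h7]; linarith
  have h2 := key k le_rfl
  have h3 := distinctProb_nonneg hp k
  have h4 : (k : ℝ) * (k - 1) ≤ 512 * n := by
    have : (k : ℝ) * (k - 1) / (512 * n) ≤ 1 := by linarith
    rwa [div_le_one (by positivity)] at this
  rcases Nat.lt_or_ge k 2 with h | h
  · have : (k : ℝ) ≤ 1 := by exact_mod_cast Nat.lt_succ_iff.mp h
    nlinarith [Nat.cast_nonneg (α := ℝ) k]
  · have : (2 : ℝ) ≤ k := by exact_mod_cast h
    nlinarith

/-! ### Random descents along surviving children -/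

/-- The number of preimages of `z` other than `x` which are reached from `t` steps away. -/
noncomputable def childCount (f : V → V) (x : V) (t : ℕ) (z : V) : ℕ :=
  (Finset.univ.filter fun y => y ≠ x ∧ f y = z ∧ ReachedAvoiding f x t y).card

/-- The probability of the backward path `u` when `u (j + 1)` is chosen uniformly among the
preimages of `u j` which can be continued to a path of full length. -/
noncomputable def descentWeight (f : V → V) (x : V) (t : ℕ) (u : Fin (t + 1) → V) : ℝ :=
  if ∀ j : Fin t, u j.succ ≠ x ∧ f (u j.succ) = u j.castSucc then
    ∏ j : Fin t, (childCount f x (t - 1 - j) (u j.castSucc) : ℝ)⁻¹ else 0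

lemma descentWeight_nonneg (f : V → V) (x : V) (t : ℕ) (u : Fin (t + 1) → V) :
    0 ≤ descentWeight f x t u := by
  unfold descentWeight
  split_ifs
  · positivity
  · rfl

omit [Fintype V] in
lemma reachedAvoiding_succ_iff (f : V → V) (x : V) (t : ℕ) (z : V) :
    ReachedAvoiding f x (t + 1) z ↔ ∃ y, y ≠ x ∧ f y = z ∧ ReachedAvoiding f x t y := by
  constructor
  · rintro ⟨v, hv, hav⟩
    refine ⟨f^[t] v, hav t (by lia), ?_, v, rfl, fun e he => hav e (by lia)⟩
    rw [← hv, Function.iterate_succ_apply']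
  · rintro ⟨y, hy, rfl, v, rfl, hav⟩
    refine ⟨v, Function.iterate_succ_apply' _ _ _, fun e he => ?_⟩
    rcases Nat.lt_succ_iff_lt_or_eq.mp he with h | rfl
    exacts [hav e h, hy]

lemma childCount_ne_zero_iff (f : V → V) (x : V) (t : ℕ) (z : V) :
    childCount f x t z ≠ 0 ↔ ReachedAvoiding f x (t + 1) z := by
  rw [reachedAvoiding_succ_iff, childCount, Finset.card_ne_zero]
  simp [Finset.Nonempty]

lemma descentWeight_cons (f : V → V) (x : V) (t : ℕ) (z : V) (u : Fin (t + 1) → V) :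
    descentWeight f x (t + 1) (Fin.cons z u) =
      if u 0 ≠ x ∧ f (u 0) = z then (childCount f x t z : ℝ)⁻¹ * descentWeight f x t u else 0 := by
  unfold descentWeight
  simp only [Fin.forall_fin_succ, Fin.prod_univ_succ]
  have : ∀ j : Fin t, t - ((j.succ : Fin (t + 1)) : ℕ) = t - 1 - j := by
    intro j; simp; lia
  simp only [this, Fin.cons_succ, Fin.castSucc_zero, Fin.cons_zero, ← Fin.succ_castSucc,
    Fin.val_zero, Nat.add_sub_cancel, Nat.sub_zero]
  by_cases h1 : u 0 ≠ x ∧ f (u 0) = z <;> simp [h1]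

lemma sum_fin_succ_eq_sum_cons {r : ℕ} (F : (Fin (r + 1) → V) → ℝ) :
    ∑ w, F w = ∑ y, ∑ w : Fin r → V, F (Fin.cons y w) := by
  rw [← Fintype.sum_prod_type', ← (Fin.consEquiv (fun _ : Fin (r+1) => V)).sum_comp]
  rfl

lemma sum_descentWeight_cons (f : V → V) (x : V) (t : ℕ) (z : V) :
    ∑ a : Fin t → V, descentWeight f x t (Fin.cons z a) =
      if ReachedAvoiding f x t z then 1 else 0 := by
  induction t generalizing z with
  | zero =>
    have : ReachedAvoiding f x 0 z := ⟨z, rfl, by simp⟩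
    simp [descentWeight, this]
  | succ t ih =>
    rw [sum_fin_succ_eq_sum_cons]
    simp only [descentWeight_cons, Fin.cons_zero]
    have h2 : ∀ y, (∑ w : Fin t → V, if y ≠ x ∧ f y = z then
        (childCount f x t z : ℝ)⁻¹ * descentWeight f x t (Fin.cons y w) else 0) =
        (childCount f x t z : ℝ)⁻¹ *
          if y ≠ x ∧ f y = z ∧ ReachedAvoiding f x t y then 1 else 0 := by
      intro y
      by_cases h : y ≠ x ∧ f y = z
      · simp only [if_pos h]
        rw [← Finset.mul_sum, ih]
        simp [h.1, h.2]
      · have h' : ¬ (y ≠ x ∧ f y = z ∧ ReachedAvoiding f x t y) := fun h3 => h ⟨h3.1, h3.2.1⟩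
        simp only [h, h', if_false]; simp
    rw [Finset.sum_congr rfl fun y _ => h2 y, ← Finset.mul_sum, Finset.sum_boole]
    change (childCount f x t z : ℝ)⁻¹ * (childCount f x t z : ℝ) = _
    split_ifs with h
    · rw [← childCount_ne_zero_iff] at h
      exact inv_mul_cancel₀ (by exact_mod_cast h)
    · rw [← childCount_ne_zero_iff, not_not] at h
      simp [h]

lemma sum_descentWeight (f : V → V) (m : ℕ) :
    ∑ u : Fin (m + 1) → V, descentWeight f (u 0) m u =
      ∑ x, if ReachedAvoiding f x m x then (1 : ℝ) else 0 := by
  rw [sum_fin_succ_eq_sum_cons]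
  simp only [Fin.cons_zero, sum_descentWeight_cons]

section

variable {f : V → V} {m : ℕ} {u : Fin (m + 1) → V}

lemma follows_of_descentWeight_ne_zero (h : descentWeight f (u 0) m u ≠ 0) (j : Fin m) :
    u j.succ ≠ u 0 ∧ f (u j.succ) = u j.castSucc := by
  unfold descentWeight at h
  split_ifs at h with h2
  · exact h2 j
  · exact absurd rfl h

omit [Fintype V] in
lemma iterate_of_follows (h : ∀ j : Fin m, f (u j.succ) = u j.castSucc) (d i : ℕ)
    (hi : i + d < m + 1) : f^[d] (u ⟨i + d, hi⟩) = u ⟨i, by lia⟩ := by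
  induction d with
  | zero => rfl
  | succ d ih =>
    rw [Function.iterate_succ_apply]
    have := h ⟨i + d, by lia⟩
    simp only [Fin.succ_mk, Fin.castSucc_mk] at this
    rw [← ih (by lia)]
    congr 1

omit [Fintype V] in
lemma injective_of_follows (h : ∀ j : Fin m, u j.succ ≠ u 0 ∧ f (u j.succ) = u j.castSucc) :
    Function.Injective u := by
  have hlt : ∀ i j : Fin (m + 1), i < j → u i ≠ u j := by
    rintro ⟨i, hi⟩ ⟨j, hj⟩ hij heq
    simp only [Fin.mk_lt_mk] at hij
    have h2 := iterate_of_follows (fun j => (h j).2) i 0 (by lia)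
    have h3 := iterate_of_follows (fun j => (h j).2) i (j - i) (by lia)
    simp only [Nat.zero_add, Nat.sub_add_cancel hij.le] at h2 h3
    rw [heq, h3] at h2
    have h4 := (h ⟨j - i - 1, by lia⟩).1
    have h5 : (⟨j - i - 1, by lia⟩ : Fin m).succ = ⟨j - i, by lia⟩ := Fin.ext (by simp; lia)
    rw [h5] at h4
    exact h4 h2
  intro i j hij
  by_contra hne
  rcases lt_or_gt_of_ne hne with h2 | h2
  exacts [hlt i j h2 hij, hlt j i h2 hij.symm]

lemma injective_of_descentWeight_ne_zero (h : descentWeight f (u 0) m u ≠ 0) :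
    Function.Injective u :=
  injective_of_follows (follows_of_descentWeight_ne_zero h)

end

/-! ### Splitting a path into an upper and a lower part -/

/-- `z` is reached after exactly `t` steps from some vertex without visiting `B` before. -/
def ReachedOutside (f : V → V) (B : Set V) (t : ℕ) (z : V) : Prop :=
  ∃ v, f^[t] v = z ∧ ∀ e < t, f^[e] v ∉ B

omit [Fintype V] in
lemma iterate_extend_eq {ι : Type*} {w : ι → V} {τ : ι → V} {f : V → V} {v : V} {t : ℕ}
    (h : ∀ e < t, (Function.extend w τ f)^[e] v ∉ Set.range w) :
    ∀ e ≤ t, (Function.extend w τ f)^[e] v = f^[e] v := by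
  intro e
  induction e with
  | zero => intro _; rfl
  | succ e ih =>
    intro he
    have h2 := h e (by lia)
    rw [Function.iterate_succ_apply', Function.iterate_succ_apply', ← ih (by lia),
      Function.extend_apply']
    simpa using h2

omit [Fintype V] in
lemma reachedOutside_range_of_follows {f : V → V} {k l : ℕ} {u : Fin (k + l + 1) → V}
    (h : ∀ j : Fin (k + l), u j.succ ≠ u 0 ∧ f (u j.succ) = u j.castSucc) :
    ReachedOutside f (Set.range fun j : Fin (k + 1) => u (Fin.castLE (by lia) j)) l
      (u ⟨k, by lia⟩) := by
  have hinj := injective_of_follows h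
  refine ⟨u (Fin.last _), ?_, ?_⟩
  · have := iterate_of_follows (fun j => (h j).2) l k (by lia)
    exact this
  · rintro e he ⟨j, hj⟩
    have := iterate_of_follows (fun j => (h j).2) e (k + l - e) (by lia)
    have h2 : (⟨k + l - e + e, by lia⟩ : Fin (k + l + 1)) = Fin.last _ :=
      Fin.ext (by simp; lia)
    rw [h2] at this
    simp only [this] at hj
    have h3 := congrArg Fin.val (hinj hj)
    simp only [Fin.val_castLE] at h3
    have := j.isLt
    lia

lemma sum_descentWeight_mul_le (f : V → V) (k l : ℕ) (q : (Fin k → V) → ℝ)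
    (hq : ∀ a, 0 ≤ q a) :
    ∑ u : Fin (k + l + 1) → V, descentWeight f (u 0) (k + l) u *
        q (fun j => u (Fin.castLE (by lia) j)) ≤
      ∑ b : Fin (k + 1) → V, q (fun j => b j.castSucc) *
        if Function.Injective b ∧ (∀ j : Fin k, f (b j.succ) = b j.castSucc) ∧
          ReachedOutside f (Set.range b) l (b (Fin.last k)) then 1 else 0 := by
  let res : (Fin (k + l + 1) → V) → Fin (k + 1) → V := fun u j => u (Fin.castLE (by lia) j)
  rw [← Finset.sum_fiberwise Finset.univ res]
  refine Finset.sum_le_sum fun b _ => ?_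
  have hle : ∑ u with res u = b, descentWeight f (u 0) (k + l) u ≤ 1 := by
    calc ∑ u with res u = b, descentWeight f (u 0) (k + l) u
        ≤ ∑ u with u 0 = b 0, descentWeight f (u 0) (k + l) u := by
          refine Finset.sum_le_sum_of_subset_of_nonneg ?_ fun _ _ _ =>
            descentWeight_nonneg _ _ _ _
          intro u
          simp only [Finset.mem_filter, Finset.mem_univ, true_and]
          rintro rfl
          rfl
      _ = ∑ a : Fin (k + l) → V, descentWeight f (b 0) (k + l) (Fin.cons (b 0) a) := by
          rw [Finset.sum_filter, sum_fin_succ_eq_sum_cons, Finset.sum_eq_single (b 0)]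
          · simp
          · intro y _ hy
            simp [hy]
          · simp
      _ ≤ 1 := by
          rw [sum_descentWeight_cons]
          split_ifs <;> norm_num
  have hmul : ∑ u with res u = b, descentWeight f (u 0) (k + l) u *
      q (fun j => u (Fin.castLE (by lia) j)) =
      q (fun j => b j.castSucc) * ∑ u with res u = b, descentWeight f (u 0) (k + l) u := by
    rw [Finset.mul_sum]
    refine Finset.sum_congr rfl fun u hu => ?_
    simp only [Finset.mem_filter, Finset.mem_univ, true_and] at hu
    rw [mul_comm, ← hu]
    rfl
  rw [hmul]
  refine mul_le_mul_of_nonneg_left ?_ (hq _)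
  split_ifs with hb
  · exact hle
  · refine (Finset.sum_eq_zero fun u hu => ?_).le
    simp only [Finset.mem_filter, Finset.mem_univ, true_and] at hu
    by_contra hne
    have hf := follows_of_descentWeight_ne_zero hne
    apply hb
    subst hu
    refine ⟨(injective_of_follows hf).comp (Fin.castLE_injective _), fun j => ?_,
      reachedOutside_range_of_follows hf⟩
    exact (hf (Fin.castLE (by lia) j)).2

lemma sum_mapWeight_reachedOutside_le (hp : ∀ v, 0 ≤ p v) (h1 : ∑ v, p v = 1)
    {k : ℕ} (l : ℕ) {b : Fin (k + 1) → V} (hb : Function.Injective b) :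
    ∑ f : V → V, mapWeight p f * (if (∀ j : Fin k, f (b j.succ) = b j.castSucc) ∧
        ReachedOutside f (Set.range b) l (b (Fin.last k)) then 1 else 0) ≤
      (∏ j : Fin k, p (b j.castSucc)) * ∑ f : V → V, mapWeight p f *
        if ReachedAvoiding f (b (Fin.last k)) l (b (Fin.last k)) then 1 else 0 := by
  have h := sum_mapWeight_prescribed h1 (fun j : Fin k => b j.succ)
    (hb.comp (Fin.succ_injective k)) (fun j => b j.castSucc)
    (fun f => if ReachedOutside f (Set.range b) l (b (Fin.last k)) then (1 : ℝ) else 0)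
  simp only [ite_and]
  rw [h]
  refine mul_le_mul_of_nonneg_left ?_ (Finset.prod_nonneg fun _ _ => hp _)
  refine Finset.sum_le_sum fun f _ => ?_
  refine mul_le_mul_of_nonneg_left ?_ (mapWeight_nonneg hp f)
  split_ifs with h2 h3 <;> try norm_num
  apply h3
  obtain ⟨v, hv, hav⟩ := h2
  have h4 := iterate_extend_eq (t := l) (v := v) (f := f) (w := fun j : Fin k => b j.succ)
    (τ := fun j => b j.castSucc)
    (fun e he hmem => hav e he (Set.range_comp_subset_range Fin.succ b hmem))
  refine ⟨v, ?_, fun e he h5 => ?_⟩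
  · rw [← h4 l le_rfl, hv]
  · apply hav e he
    rw [h4 e he.le, h5]
    exact ⟨_, rfl⟩

lemma sum_mapWeight_descentWeight_le (hp : ∀ v, 0 ≤ p v) (h1 : ∑ v, p v = 1)
    (k l : ℕ) (q : (Fin k → V) → ℝ) (hq : ∀ a, 0 ≤ q a) :
    ∑ f : V → V, mapWeight p f * ∑ u : Fin (k + l + 1) → V,
        descentWeight f (u 0) (k + l) u * q (fun j => u (Fin.castLE (by lia) j)) ≤
      (∑ a : Fin k → V, (∏ j, p (a j)) * q a) * expectedEndpoints p l := by
  calc _ ≤ ∑ f : V → V, mapWeight p f * ∑ b : Fin (k + 1) → V, q (fun j => b j.castSucc) *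
        if Function.Injective b ∧ (∀ j : Fin k, f (b j.succ) = b j.castSucc) ∧
          ReachedOutside f (Set.range b) l (b (Fin.last k)) then 1 else 0 :=
        Finset.sum_le_sum fun f _ => mul_le_mul_of_nonneg_left
          (sum_descentWeight_mul_le f k l q hq) (mapWeight_nonneg hp f)
    _ = ∑ b : Fin (k + 1) → V, q (fun j => b j.castSucc) * ∑ f : V → V, mapWeight p f *
        if Function.Injective b ∧ (∀ j : Fin k, f (b j.succ) = b j.castSucc) ∧
          ReachedOutside f (Set.range b) l (b (Fin.last k)) then 1 else 0 := by
        simp only [Finset.mul_sum]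
        rw [Finset.sum_comm]
        refine Finset.sum_congr rfl fun b _ => Finset.sum_congr rfl fun f _ => ?_
        ring
    _ ≤ ∑ b : Fin (k + 1) → V, q (fun j => b j.castSucc) * ((∏ j : Fin k, p (b j.castSucc)) *
        ∑ f : V → V, mapWeight p f *
          if ReachedAvoiding f (b (Fin.last k)) l (b (Fin.last k)) then 1 else 0) := by
        refine Finset.sum_le_sum fun b _ => mul_le_mul_of_nonneg_left ?_ (hq _)
        by_cases hb : Function.Injective b
        · simpa only [hb, true_and] using sum_mapWeight_reachedOutside_le hp h1 l hb
        · simp only [hb, false_and, if_false, mul_zero, Finset.sum_const_zero]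
          refine mul_nonneg (Finset.prod_nonneg fun _ _ => hp _) (Finset.sum_nonneg fun f _ =>
            mul_nonneg (mapWeight_nonneg hp f) ?_)
          split_ifs <;> norm_num
    _ = _ := by
        rw [sum_fin_succ_eq_sum_snoc, Finset.sum_mul]
        refine Finset.sum_congr rfl fun a _ => ?_
        simp only [Fin.snoc_castSucc, Fin.snoc_last]
        rw [← Finset.mul_sum, ← Finset.mul_sum, Finset.sum_comm, expectedEndpoints]
        simp only [Finset.mul_sum]
        rw [Finset.sum_congr rfl fun _ _ => Finset.sum_congr rfl fun _ _ => ?_]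
        ring


/-! ### Attaching a chain to a path -/

/-- The values prescribed along a chain `w` which enters `z`. -/
def chainTarget {r : ℕ} (z : V) (w : Fin (r + 1) → V) : Fin (r + 1) → V :=
  Fin.cons z fun j : Fin r => w j.castSucc

section

variable {f : V → V} {m r : ℕ} {u : Fin (m + 1) → V} {w : Fin (r + 1) → V}

omit [Fintype V] in
lemma extend_chainTarget_apply (hd : ∀ a j, w a ≠ u j) (i j : Fin (m + 1)) :
    Function.extend w (chainTarget (u i) w) f (u j) = f (u j) := by
  rw [Function.extend_apply']
  rintro ⟨a, ha⟩
  exact hd a j ha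

omit [Fintype V] in
lemma reachedAvoiding_of_follows (h : ∀ j : Fin m, u j.succ ≠ u 0 ∧ f (u j.succ) = u j.castSucc)
    (j : Fin m) : ReachedAvoiding f (u 0) (m - 1 - j) (u j.succ) := by
  have hj := j.isLt
  have hu : ∀ e (he : e ≤ m), f^[e] (u (Fin.last m)) = u ⟨m - e, by lia⟩ := by
    intro e he
    have h2 := iterate_of_follows (fun j => (h j).2) e (m - e) (by lia)
    have h3 : (⟨m - e + e, by lia⟩ : Fin (m + 1)) = Fin.last m := Fin.ext (by simp; lia)
    rwa [h3] at h2
  refine ⟨u (Fin.last m), ?_, fun e he => ?_⟩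
  · rw [hu _ (by lia)]
    congr 1
    exact Fin.ext (by simp; lia)
  · rw [hu _ (by lia)]
    have := (h ⟨m - e - 1, by lia⟩).1
    convert this using 2
    exact Fin.ext (by simp; lia)

lemma one_le_childCount (h : ∀ j : Fin m, u j.succ ≠ u 0 ∧ f (u j.succ) = u j.castSucc)
    (j : Fin m) : 1 ≤ childCount f (u 0) (m - 1 - j) (u j.castSucc) := by
  rw [childCount, Nat.one_le_iff_ne_zero, Finset.card_ne_zero]
  exact ⟨u j.succ, by simpa using ⟨(h j).1, (h j).2, reachedAvoiding_of_follows h j⟩⟩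

omit [Fintype V] in
lemma reachedAvoiding_of_extend
    (h : ∀ j : Fin m, u j.succ ≠ u 0 ∧ f (u j.succ) = u j.castSucc)
    (hw : Function.Injective w) (hd : ∀ a j, w a ≠ u j) (i : Fin (m + 1)) (j : Fin m) {y : V}
    (hy : y ∉ Set.range w) (hyx : y ≠ u 0) (hfy : f y = u j.castSucc)
    (hr : ReachedAvoiding (Function.extend w (chainTarget (u i) w) f) (u 0) (m - 1 - j) y) :
    ReachedAvoiding f (u 0) (m - 1 - j) y := by
  set g := Function.extend w (chainTarget (u i) w) f with hg
  obtain ⟨v, hv, hav⟩ := hr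
  by_cases hout : ∀ e < m - 1 - (j : ℕ), g^[e] v ∉ Set.range w
  · have h2 := iterate_extend_eq hout
    refine ⟨v, by rw [← h2 _ le_rfl, ← hv], fun e he => ?_⟩
    rw [← h2 e he.le]
    exact hav e he
  · push Not at hout
    obtain ⟨e, he, hmem⟩ := hout
    have hstep : ∀ z, z ∈ Set.range w ∪ Set.range u → z ≠ u 0 →
        g z ∈ Set.range w ∪ Set.range u := by
      rintro z (⟨a, rfl⟩ | ⟨a, rfl⟩) hz
      · rw [hg, hw.extend_apply]
        refine Fin.cases ?_ (fun a => ?_) a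
        · exact Or.inr ⟨i, rfl⟩
        · exact Or.inl ⟨a.castSucc, rfl⟩
      · rw [hg, extend_chainTarget_apply hd]
        obtain ⟨a, rfl⟩ := Fin.exists_succ_eq.mpr (fun h0 => hz (congrArg u h0))
        exact Or.inr ⟨a.castSucc, (h a).2.symm⟩
    have hall : ∀ d, e + d ≤ m - 1 - (j : ℕ) → g^[e + d] v ∈ Set.range w ∪ Set.range u := by
      intro d
      induction d with
      | zero => intro _; exact Or.inl hmem
      | succ d ih =>
        intro hed
        rw [← add_assoc, Function.iterate_succ_apply']
        exact hstep _ (ih (by lia)) (hav _ (by lia))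
    have h3 := hall (m - 1 - j - e) (by lia)
    rw [Nat.add_sub_cancel' he.le, hv] at h3
    obtain ⟨a, rfl⟩ := h3.resolve_left hy
    obtain ⟨a, rfl⟩ := Fin.exists_succ_eq.mpr (fun h0 => hyx (congrArg u h0))
    rw [(h a).2] at hfy
    have := Fin.castSucc_injective _ (injective_of_follows h hfy)
    rw [this]
    exact reachedAvoiding_of_follows h j

lemma childCount_extend_le
    (h : ∀ j : Fin m, u j.succ ≠ u 0 ∧ f (u j.succ) = u j.castSucc)
    (hw : Function.Injective w) (hd : ∀ a j, w a ≠ u j) (i : Fin (m + 1)) (j : Fin m) :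
    childCount (Function.extend w (chainTarget (u i) w) f) (u 0) (m - 1 - j) (u j.castSucc) ≤
      childCount f (u 0) (m - 1 - j) (u j.castSucc) + if j.castSucc = i then 1 else 0 := by
  unfold childCount
  have hc : (if j.castSucc = i then 1 else 0) =
      (if j.castSucc = i then {w 0} else ∅ : Finset V).card := by
    split_ifs <;> simp
  rw [hc]
  refine (Finset.card_le_card fun y hy => ?_).trans (Finset.card_union_le _ _)
  simp only [Finset.mem_filter, Finset.mem_univ, true_and] at hy
  obtain ⟨hyx, hgy, hr⟩ := hy
  rw [Finset.mem_union]
  by_cases hyw : y ∈ Set.range w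
  · right
    obtain ⟨a, rfl⟩ := hyw
    rw [hw.extend_apply] at hgy
    induction a using Fin.cases with
    | zero =>
      have := injective_of_follows h (show u i = u j.castSucc from hgy)
      simp [this]
    | succ a => exact absurd hgy (hd a.castSucc _)
  · left
    have hfy : f y = u j.castSucc := by
      rwa [Function.extend_apply' _ _ _ (by simpa using hyw)] at hgy
    simp only [Finset.mem_filter, Finset.mem_univ, true_and]
    exact ⟨hyx, hfy, reachedAvoiding_of_extend h hw hd i j hyw hyx hfy hr⟩

lemma half_descentWeight_le_extend (hw : Function.Injective w) (hd : ∀ a j, w a ≠ u j)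
    (i : Fin (m + 1)) :
    descentWeight f (u 0) m u / 2 ≤
      descentWeight (Function.extend w (chainTarget (u i) w) f) (u 0) m u := by
  by_cases h0 : descentWeight f (u 0) m u = 0
  · rw [h0, zero_div]
    exact descentWeight_nonneg _ _ _ _
  have h := follows_of_descentWeight_ne_zero h0
  set g := Function.extend w (chainTarget (u i) w) f with hg
  have h' : ∀ j : Fin m, u j.succ ≠ u 0 ∧ g (u j.succ) = u j.castSucc := fun j =>
    ⟨(h j).1, by rw [hg, extend_chainTarget_apply hd, (h j).2]⟩
  unfold descentWeight
  rw [if_pos h, if_pos h']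
  have hhalf : (1 / 2 : ℝ) ≤ ∏ j : Fin m, if j.castSucc = i then (1 / 2 : ℝ) else 1 := by
    induction i using Fin.lastCases with
    | last => simp [Fin.castSucc_ne_last]; norm_num
    | cast i => simp [Fin.castSucc_inj]
  calc _ ≤ (∏ j : Fin m, (childCount f (u 0) (m - 1 - j) (u j.castSucc) : ℝ)⁻¹) *
        ∏ j : Fin m, if j.castSucc = i then (1 / 2 : ℝ) else 1 := by
        rw [div_eq_mul_one_div]
        exact mul_le_mul_of_nonneg_left hhalf (Finset.prod_nonneg fun _ _ => by positivity)
    _ ≤ _ := by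
        rw [← Finset.prod_mul_distrib]
        refine Finset.prod_le_prod (fun j _ => ?_) fun j _ => ?_
        · split_ifs <;> positivity
        · have h1 : (1 : ℝ) ≤ childCount f (u 0) (m - 1 - j) (u j.castSucc) := by
            exact_mod_cast one_le_childCount h j
          have h2 : (1 : ℝ) ≤ childCount g (u 0) (m - 1 - j) (u j.castSucc) := by
            exact_mod_cast one_le_childCount h' j
          have h3 : (childCount g (u 0) (m - 1 - j) (u j.castSucc) : ℝ) ≤
              childCount f (u 0) (m - 1 - j) (u j.castSucc) +
                if j.castSucc = i then 1 else 0 := by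
            exact_mod_cast childCount_extend_le h hw hd i j
          split_ifs at h3 ⊢
          · rw [mul_one_div, div_eq_mul_inv, ← mul_inv]
            exact inv_anti₀ (by linarith) (by linarith)
          · rw [mul_one]
            exact inv_anti₀ (by linarith) (by linarith)

end

lemma sum_mapWeight_attached_ge (hp : ∀ v, 0 ≤ p v) (h1 : ∑ v, p v = 1) {m r : ℕ}
    {u : Fin (m + 1) → V} {w : Fin (r + 1) → V} (hw : Function.Injective w)
    (hd : ∀ a j, w a ≠ u j) (i : Fin (m + 1)) :
    p (u i) * (∏ j : Fin r, p (w j.castSucc)) *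
        (∑ f : V → V, mapWeight p f * descentWeight f (u 0) m u) ≤
      2 * ∑ f : V → V, mapWeight p f *
        if ∀ j, f (w j) = chainTarget (u i) w j then descentWeight f (u 0) m u else 0 := by
  rw [sum_mapWeight_prescribed h1 w hw (chainTarget (u i) w)
    (fun f => descentWeight f (u 0) m u), Fin.prod_univ_succ]
  simp only [chainTarget, Fin.cons_zero, Fin.cons_succ]
  have h2 : (∑ f : V → V, mapWeight p f * descentWeight f (u 0) m u) ≤
      2 * ∑ f : V → V, mapWeight p f *
        descentWeight (Function.extend w (chainTarget (u i) w) f) (u 0) m u := by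
    rw [Finset.mul_sum]
    refine Finset.sum_le_sum fun f _ => ?_
    have := mul_le_mul_of_nonneg_left (half_descentWeight_le_extend (f := f) hw hd i)
      (mapWeight_nonneg hp f)
    linarith
  have h3 : 0 ≤ p (u i) * ∏ j : Fin r, p (w j.castSucc) :=
    mul_nonneg (hp _) (Finset.prod_nonneg fun _ _ => hp _)
  have := mul_le_mul_of_nonneg_left h2 h3
  simp only [chainTarget] at this
  linarith

/-! ### Counting attached chains -/

/-- `w` is a chain of pairwise distinct vertices which avoids `u`. -/
def IsChainOff {m r : ℕ} (u : Fin m → V) (w : Fin r → V) : Prop :=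
  Function.Injective w ∧ ∀ a j, w a ≠ u j

omit [Fintype V] in
lemma iterate_chainTarget {f : V → V} {r : ℕ} {z : V} {w : Fin (r + 1) → V}
    (h : ∀ j, f (w j) = chainTarget z w j) :
    (∀ e ≤ r, f^[e] (w (Fin.last r)) = w ⟨r - e, by lia⟩) ∧
      f^[r + 1] (w (Fin.last r)) = z := by
  have h1 : ∀ e ≤ r, f^[e] (w (Fin.last r)) = w ⟨r - e, by lia⟩ := by
    intro e he
    have h2 := iterate_of_follows (f := f) (u := w) (fun j => h j.succ) e (r - e) (by lia)
    have h3 : (⟨r - e + e, by lia⟩ : Fin (r + 1)) = Fin.last r := Fin.ext (by simp; lia)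
    rwa [h3] at h2
  refine ⟨h1, ?_⟩
  rw [Function.iterate_succ_apply', h1 r le_rfl]
  have : (⟨r - r, by lia⟩ : Fin (r + 1)) = 0 := Fin.ext (by simp)
  rw [this]
  exact h 0

lemma sum_attached_le {f : V → V} {m : ℕ} {u : Fin (m + 1) → V}
    (h : ∀ j : Fin m, u j.succ ≠ u 0 ∧ f (u j.succ) = u j.castSucc) (k : ℕ) :
    ∑ r : Fin k, ∑ i : Fin (m + 1), ∑ w : Fin (r + 1) → V,
        (if IsChainOff u w ∧ ∀ j, f (w j) = chainTarget (u i) w j then (1 : ℝ) else 0) ≤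
      (Finset.univ.filter fun y => ∃ d ≤ m + k, f^[d] y = u 0).card := by
  have hsum : ∑ r : Fin k, ∑ i : Fin (m + 1), ∑ w : Fin (r + 1) → V,
        (if IsChainOff u w ∧ ∀ j, f (w j) = chainTarget (u i) w j then (1 : ℝ) else 0) =
      ((Finset.univ.filter fun c : (r : Fin k) × (Fin (m + 1) × (Fin (r + 1) → V)) =>
        IsChainOff u c.2.2 ∧ ∀ j, f (c.2.2 j) = chainTarget (u c.2.1) c.2.2 j).card : ℝ) := by
    rw [← Finset.sum_boole, Fintype.sum_sigma]
    simp only [Fintype.sum_prod_type]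
  rw [hsum, Nat.cast_le]
  refine Finset.card_le_card_of_injOn (fun c => c.2.2 (Fin.last _)) ?_ ?_
  · rintro ⟨r, i, w⟩ hc
    simp only [Finset.coe_filter, Finset.mem_univ, true_and, Set.mem_ofPred_eq] at hc ⊢
    refine ⟨i + (r + 1), by lia, ?_⟩
    rw [Function.iterate_add_apply, (iterate_chainTarget hc.2).2]
    have := iterate_of_follows (fun j => (h j).2) i 0 (by lia)
    simpa using this
  · have hlt : ∀ c d : (r : Fin k) × (Fin (m + 1) × (Fin (r + 1) → V)),
        (∀ j, f (c.2.2 j) = chainTarget (u c.2.1) c.2.2 j) →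
        (IsChainOff u d.2.2 ∧ ∀ j, f (d.2.2 j) = chainTarget (u d.2.1) d.2.2 j) →
        c.2.2 (Fin.last _) = d.2.2 (Fin.last _) → ¬ c.1 < d.1 := by
      rintro ⟨r, i, w⟩ ⟨s, j, w'⟩ hc hd he hrs
      dsimp only at hc hd he hrs
      have h2 := (iterate_chainTarget hc).2
      rw [he, (iterate_chainTarget hd.2).1 (r + 1) (by simpa using hrs)] at h2
      exact hd.1.2 _ _ h2
    intro c hc d hd he
    simp only [Finset.coe_filter, Finset.mem_univ, true_and, Set.mem_ofPred_eq] at hc hd he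
    have hr : c.1 = d.1 := le_antisymm (not_lt.mp (hlt d c hd.2 hc he.symm))
      (not_lt.mp (hlt c d hc.2 hd he))
    obtain ⟨r, i, w⟩ := c
    obtain ⟨s, j, w'⟩ := d
    dsimp only at hr
    subst hr
    dsimp only at hc hd he
    have h2 := iterate_chainTarget hc.2
    have h3 := iterate_chainTarget hd.2
    have hw : w = w' := by
      funext a
      have h4 := h2.1 (r - a) (by lia)
      rw [he, h3.1 (r - a) (by lia)] at h4
      have h5 : (⟨r - (r - a), by lia⟩ : Fin (r + 1)) = a := Fin.ext (by simp; lia)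
      rw [h5] at h4
      exact h4.symm
    have hi : i = j := injective_of_follows h (by rw [← h2.2, ← h3.2, he])
    rw [hw, hi]

lemma sum_descentWeight_mul_card_le (f : V → V) (m l : ℕ) :
    ∑ u : Fin (m + 1) → V, descentWeight f (u 0) m u *
        ((Finset.univ.filter fun y => ∃ d ≤ l, f^[d] y = u 0).card : ℝ) ≤
      Fintype.card V * (l + 1) := by
  rw [sum_fin_succ_eq_sum_cons]
  simp only [Fin.cons_zero, ← Finset.sum_mul, sum_descentWeight_cons]
  have h2 : ∑ x, (Finset.univ.filter fun y => ∃ d ≤ l, f^[d] y = x).card ≤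
      Fintype.card V * (l + 1) := by
    calc _ ≤ ∑ x, ∑ d ∈ Finset.range (l + 1), (Finset.univ.filter fun y => f^[d] y = x).card := by
          refine Finset.sum_le_sum fun x _ => ?_
          refine (Finset.card_le_card ?_).trans Finset.card_biUnion_le
          intro y
          simp
      _ = _ := by
          rw [Finset.sum_comm]
          have h3 : ∀ d, ∑ x, (Finset.univ.filter fun y => f^[d] y = x).card =
              Fintype.card V := fun d =>
            (Finset.card_eq_sum_card_fiberwise (f := f^[d]) fun y _ => Finset.mem_univ _).symm
          simp [h3, mul_comm]
  calc _ ≤ ∑ x, ((Finset.univ.filter fun y => ∃ d ≤ l, f^[d] y = x).card : ℝ) := by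
        refine Finset.sum_le_sum fun x _ => ?_
        split_ifs <;> simp
    _ ≤ _ := by exact_mod_cast h2

lemma sum_isChainOff_ge (hp : ∀ v, 0 ≤ p v) (h1 : ∑ v, p v = 1) {m : ℕ} {u : Fin m → V}
    (hu : Function.Injective u) (r : ℕ) :
    distinctProb p r - r * ∑ i, p (u i) ≤
      ∑ w : Fin r → V, if IsChainOff u w then ∏ j, p (w j) else 0 := by
  have hμ : ∀ j : Fin r, ∑ w : Fin r → V, (∏ i, p (w i)) *
      (if ∃ i, w j = u i then (1 : ℝ) else 0) = ∑ i, p (u i) := by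
    intro j
    rw [sum_prod_mul_apply h1 j (fun v => if ∃ i, v = u i then (1 : ℝ) else 0)]
    simp only [mul_ite, mul_one, mul_zero]
    rw [← Finset.sum_filter, ← Finset.sum_image (f := p) (s := Finset.univ) hu.injOn]
    congr 1
    ext v
    simp [eq_comm]
  have h2 : (r : ℝ) * ∑ i, p (u i) = ∑ w : Fin r → V, ∑ j : Fin r, (∏ i, p (w i)) *
      (if ∃ i, w j = u i then (1 : ℝ) else 0) := by
    rw [Finset.sum_comm]
    simp only [hμ, Finset.sum_const, Finset.card_univ, Fintype.card_fin, nsmul_eq_mul]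
  rw [h2, distinctProb, ← Finset.sum_sub_distrib]
  refine Finset.sum_le_sum fun w _ => ?_
  rw [← Finset.mul_sum]
  have h3 : 0 ≤ ∏ i, p (w i) := Finset.prod_nonneg fun _ _ => hp _
  have h4 : 0 ≤ ∑ j : Fin r, if ∃ i, w j = u i then (1 : ℝ) else 0 :=
    Finset.sum_nonneg fun _ _ => by split_ifs <;> norm_num
  have h5 := mul_nonneg h3 h4
  by_cases hw : Function.Injective w
  · by_cases hd : ∃ j i, w j = u i
    · obtain ⟨j, hj⟩ := hd
      have h6 : (1 : ℝ) ≤ ∑ j : Fin r, if ∃ i, w j = u i then (1 : ℝ) else 0 := by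
        have := Finset.single_le_sum (f := fun j : Fin r => if ∃ i, w j = u i then (1 : ℝ) else 0)
          (fun _ _ => by split_ifs <;> norm_num) (Finset.mem_univ j)
        simpa only [if_pos hj] using this
      have h7 := mul_le_mul_of_nonneg_left h6 h3
      rw [if_pos hw]
      have h8 : 0 ≤ if IsChainOff u w then ∏ j, p (w j) else 0 := by
        split_ifs
        exacts [h3, le_rfl]
      linarith
    · push Not at hd
      rw [if_pos hw, if_pos ⟨hw, hd⟩]
      linarith
  · rw [if_neg hw, if_neg fun h => hw h.1]
    linarith

lemma sum_isChainOff_succ_ge (hp : ∀ v, 0 ≤ p v) {m : ℕ} (u : Fin m → V) (r : ℕ) :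
    (Fintype.card V - (r + m : ℝ)) *
        (∑ w : Fin r → V, if IsChainOff u w then ∏ j, p (w j) else 0) ≤
      ∑ w : Fin (r + 1) → V, if IsChainOff u w then ∏ j : Fin r, p (w j.castSucc) else 0 := by
  rw [sum_fin_succ_eq_sum_snoc, Finset.mul_sum]
  refine Finset.sum_le_sum fun w _ => ?_
  simp only [Fin.snoc_castSucc]
  have h3 : 0 ≤ ∏ i, p (w i) := Finset.prod_nonneg fun _ _ => hp _
  split_ifs with hw
  · rw [← Finset.sum_filter, Finset.sum_const, nsmul_eq_mul]
    refine mul_le_mul_of_nonneg_right ?_ h3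
    have h4 : (Finset.univ : Finset V) ⊆
        (Finset.univ.filter fun y => IsChainOff u (Fin.snoc w y : Fin (r + 1) → V)) ∪
          (Finset.univ.image w ∪ Finset.univ.image u) := by
      intro y _
      by_contra hy
      simp only [Finset.mem_union, Finset.mem_filter, Finset.mem_image, Finset.mem_univ,
        true_and, not_or, not_exists] at hy
      refine hy.1 ⟨(snoc_injective_iff _ _).mpr ⟨hw.1, hy.2.1⟩, fun a => ?_⟩
      refine Fin.lastCases ?_ (fun a => ?_) a
      · intro j
        rw [Fin.snoc_last]
        exact fun h => hy.2.2 j h.symm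
      · rw [Fin.snoc_castSucc]
        exact hw.2 a
    have h5 := Finset.card_le_card h4
    have h6 : (Finset.univ.image w ∪ Finset.univ.image u).card ≤ r + m := by
      refine (Finset.card_union_le _ _).trans (add_le_add ?_ ?_) <;>
        exact Finset.card_image_le.trans (by simp)
    have h7 := h5.trans ((Finset.card_union_le _ _).trans (Nat.add_le_add_left h6 _))
    rw [Finset.card_univ] at h7
    rw [sub_le_iff_le_add]
    exact_mod_cast h7
  · rw [mul_zero]
    refine Finset.sum_nonneg fun y _ => ?_
    split_ifs
    exacts [h3, le_rfl]

/-- The total weight of the chains of length at most `k` which can be attached to `u`. -/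
noncomputable def chainMass (p : V → ℝ) (k : ℕ) {m : ℕ} (u : Fin (m + 1) → V) : ℝ :=
  ∑ r : Fin k, ∑ i : Fin (m + 1), ∑ w : Fin (r + 1) → V,
    if IsChainOff u w then p (u i) * ∏ j : Fin r, p (w j.castSucc) else 0

lemma sum_descentWeight_mul_chainMass_le (hp : ∀ v, 0 ≤ p v) (h1 : ∑ v, p v = 1) (m k : ℕ) :
    ∑ u : Fin (m + 1) → V, (∑ f : V → V, mapWeight p f * descentWeight f (u 0) m u) *
        chainMass p k u ≤ 2 * (Fintype.card V * ((m + k : ℕ) + 1)) := by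
  have hu : ∀ u : Fin (m + 1) → V,
      (∑ f : V → V, mapWeight p f * descentWeight f (u 0) m u) * chainMass p k u ≤
        2 * ∑ f : V → V, mapWeight p f * (descentWeight f (u 0) m u *
          ((Finset.univ.filter fun y => ∃ d ≤ m + k, f^[d] y = u 0).card : ℝ)) := by
    intro u
    calc _ ≤ ∑ r : Fin k, ∑ i : Fin (m + 1), ∑ w : Fin (r + 1) → V,
          2 * ∑ f : V → V, mapWeight p f * (descentWeight f (u 0) m u *
            if IsChainOff u w ∧ ∀ j, f (w j) = chainTarget (u i) w j then 1 else 0) := by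
          unfold chainMass
          simp only [Finset.mul_sum (a := ∑ f : V → V, mapWeight p f * descentWeight f (u 0) m u)]
          refine Finset.sum_le_sum fun r _ => Finset.sum_le_sum fun i _ =>
            Finset.sum_le_sum fun w _ => ?_
          by_cases hw : IsChainOff u w
          · rw [if_pos hw, mul_comm]
            simpa only [hw, true_and, mul_ite, mul_one, mul_zero] using
              sum_mapWeight_attached_ge hp h1 hw.1 hw.2 i
          · simp [hw]
      _ = 2 * ∑ f : V → V, mapWeight p f * (descentWeight f (u 0) m u *
          ∑ r : Fin k, ∑ i : Fin (m + 1), ∑ w : Fin (r + 1) → V,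
            if IsChainOff u w ∧ ∀ j, f (w j) = chainTarget (u i) w j then (1 : ℝ) else 0) := by
          simp only [← Finset.mul_sum]
          congr 1
          simp only [Finset.mul_sum]
          symm
          rw [Finset.sum_comm]
          refine Finset.sum_congr rfl fun r _ => ?_
          rw [Finset.sum_comm]
          exact Finset.sum_congr rfl fun i _ => Finset.sum_comm
      _ ≤ _ := by
          refine mul_le_mul_of_nonneg_left (Finset.sum_le_sum fun f _ => ?_) zero_le_two
          refine mul_le_mul_of_nonneg_left ?_ (mapWeight_nonneg hp f)
          by_cases h0 : descentWeight f (u 0) m u = 0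
          · simp [h0]
          · exact mul_le_mul_of_nonneg_left
              (sum_attached_le (follows_of_descentWeight_ne_zero h0) k)
              (descentWeight_nonneg _ _ _ _)
  refine (Finset.sum_le_sum fun u _ => hu u).trans ?_
  rw [← Finset.mul_sum, Finset.sum_comm]
  refine mul_le_mul_of_nonneg_left ?_ zero_le_two
  simp only [← Finset.mul_sum]
  calc _ ≤ ∑ f : V → V, mapWeight p f * (Fintype.card V * ((m + k : ℕ) + 1)) :=
        Finset.sum_le_sum fun f _ => mul_le_mul_of_nonneg_left
          (sum_descentWeight_mul_card_le f m (m + k)) (mapWeight_nonneg hp f)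
    _ = _ := by rw [← Finset.sum_mul, sum_mapWeight h1, one_mul]

lemma min_le_sum_mul_max {μ : ℝ} (hμ : 0 ≤ μ) (k : ℕ) :
    min (k * μ) (1 / 16) / 16 ≤ ∑ r : Fin k, μ * max 0 (1 / 8 - (r : ℕ) * μ) := by
  rw [Fin.sum_univ_eq_sum_range (fun r => μ * max 0 (1 / 8 - (r : ℝ) * μ))]
  have key : ∀ R ≤ k, (∀ r < R, (r : ℝ) * μ ≤ 1 / 16) →
      R * μ / 16 ≤ ∑ r ∈ Finset.range k, μ * max 0 (1 / 8 - (r : ℝ) * μ) := by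
    intro R hR hr
    calc R * μ / 16 = ∑ r ∈ Finset.range R, μ * (1 / 16) := by simp; ring
      _ ≤ ∑ r ∈ Finset.range R, μ * max 0 (1 / 8 - (r : ℝ) * μ) := by
          refine Finset.sum_le_sum fun r hr' => mul_le_mul_of_nonneg_left ?_ hμ
          have := hr r (Finset.mem_range.mp hr')
          exact le_max_of_le_right (by linarith)
      _ ≤ _ := Finset.sum_le_sum_of_subset_of_nonneg
          (Finset.range_mono hR) fun r _ _ => mul_nonneg hμ (le_max_left _ _)
  by_cases h : k * μ ≤ 1 / 16
  · refine le_trans ?_ (key k le_rfl fun r hr => ?_)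
    · gcongr
      exact min_le_left _ _
    · refine le_trans ?_ h
      gcongr
  · push Not at h
    have hμ0 : 0 < μ := by
      rcases hμ.eq_or_lt with rfl | h0
      · norm_num at h
      · exact h0
    set R := ⌊1 / (16 * μ)⌋₊ with hR
    have h2 : (R : ℝ) ≤ 1 / (16 * μ) := Nat.floor_le (by positivity)
    have h3 : 1 / (16 * μ) < R + 1 := Nat.lt_floor_add_one _
    have h4 : (R : ℝ) * μ ≤ 1 / 16 := by
      calc (R : ℝ) * μ ≤ 1 / (16 * μ) * μ := by gcongr
        _ = 1 / 16 := by field_simp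
    have h5 : 1 / 16 ≤ ((R + 1 : ℕ) : ℝ) * μ := by
      calc (1 / 16 : ℝ) = 1 / (16 * μ) * μ := by field_simp
        _ ≤ _ := by push_cast; gcongr
    have h6 : R < k := by
      have : (R : ℝ) * μ < k * μ := h4.trans_lt h
      exact_mod_cast lt_of_mul_lt_mul_right this hμ
    refine le_trans ?_ (key (R + 1) h6 fun r hr => ?_)
    · gcongr
      exact (min_le_right _ _).trans h5
    · refine le_trans ?_ h4
      gcongr
      lia

lemma min_le_chainMass (hp : ∀ v, 0 ≤ p v) (h1 : ∑ v, p v = 1) {k : ℕ}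
    (hD : 1 / 8 ≤ distinctProb p k) (hk : 8 * k ≤ Fintype.card V) {u : Fin (k + k + 1) → V}
    (hu : Function.Injective u) :
    Fintype.card V / 2 * (min (k * ∑ i, p (u i)) (1 / 16) / 16) ≤ chainMass p k u := by
  have hμ : 0 ≤ ∑ i, p (u i) := Finset.sum_nonneg fun _ _ => hp _
  refine (mul_le_mul_of_nonneg_left (min_le_sum_mul_max hμ k) (by positivity)).trans ?_
  unfold chainMass
  rw [Finset.mul_sum]
  refine Finset.sum_le_sum fun r _ => ?_
  have hS : 0 ≤ ∑ w : Fin r → V, if IsChainOff u w then ∏ j, p (w j) else 0 :=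
    Finset.sum_nonneg fun w _ => by
      split_ifs
      exacts [Finset.prod_nonneg fun _ _ => hp _, le_rfl]
  have h2 : max 0 (1 / 8 - (r : ℕ) * ∑ i, p (u i)) ≤
      ∑ w : Fin r → V, if IsChainOff u w then ∏ j, p (w j) else 0 := by
    refine max_le hS ?_
    have h3 := sum_isChainOff_ge hp h1 hu r
    have h4 := distinctProb_antitone hp h1 r.isLt.le
    linarith
  have h5 : (Fintype.card V : ℝ) / 2 ≤ Fintype.card V - (((r : ℕ) : ℝ) + (k + k + 1 : ℕ)) := by
    have h6 : (8 * k : ℝ) ≤ Fintype.card V := by exact_mod_cast hk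
    have h7 : (((r : ℕ) : ℝ) + 1) ≤ k := by exact_mod_cast r.isLt
    push_cast
    linarith
  have h8 := sum_isChainOff_succ_ge hp u r
  have h9 : Fintype.card V / 2 * max 0 (1 / 8 - (r : ℕ) * ∑ i, p (u i)) ≤
      ∑ w : Fin (r + 1) → V, if IsChainOff u w then ∏ j : Fin r, p (w j.castSucc) else 0 :=
    (mul_le_mul h5 h2 (le_max_left _ _) (le_trans (by positivity) h5)).trans h8
  calc _ = (∑ i, p (u i)) * (Fintype.card V / 2 * max 0 (1 / 8 - (r : ℕ) * ∑ i, p (u i))) := by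
        ring
    _ ≤ _ := mul_le_mul_of_nonneg_left h9 hμ
    _ = _ := by
        rw [Finset.sum_mul]
        simp only [Finset.mul_sum, mul_ite, mul_zero]

lemma mul_sub_lightCount_le_chainMass (hp : ∀ v, 0 ≤ p v) (h1 : ∑ v, p v = 1) {k : ℕ}
    (hD : 1 / 8 ≤ distinctProb p k) (hk : 8 * k ≤ Fintype.card V) (hn : 1 ≤ Fintype.card V)
    {u : Fin (k + k + 1) → V} (hu : Function.Injective u) :
    k * (k - lightCount p (1 / (16 * Fintype.card V)) fun j : Fin k => u (Fin.castLE (by lia) j)) ≤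
      2 ^ 19 * chainMass p k u := by
  have hmin := min_le_chainMass hp h1 hD hk hu
  have hsq := sq_le_of_le_distinctProb hp h1 hn hD
  set n : ℝ := (Fintype.card V : ℝ) with hn_def
  have hn0 : (1 : ℝ) ≤ n := Nat.one_le_cast.mpr hn
  have hX := lightCount_nonneg (p := p) (1 / (16 * n)) fun j : Fin k => u (Fin.castLE (by lia) j)
  have hμX := mul_sub_lightCount_le hp (1 / (16 * n)) fun j : Fin k => u (Fin.castLE (by lia) j)
  set X := lightCount p (1 / (16 * n)) fun j : Fin k => u (Fin.castLE (by lia) j)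
  have hμ : ∑ j : Fin k, p (u (Fin.castLE (by lia) j)) ≤ ∑ i, p (u i) := by
    rw [← Finset.sum_image (f := fun i => p (u i)) (s := Finset.univ)
      (Fin.castLE_injective (by lia)).injOn]
    exact Finset.sum_le_sum_of_subset_of_nonneg (Finset.subset_univ _) fun _ _ _ => hp _
  have h2 : (k : ℝ) * (k - X) / (16 * n) ≤ k * ∑ i, p (u i) := by
    calc (k : ℝ) * (k - X) / (16 * n) = k * (1 / (16 * n) * (k - X)) := by ring
      _ ≤ _ := by
        gcongr
        exact hμX.trans hμ
  have h3 : (k : ℝ) * (k - X) / (16 * n) / 1024 ≤ min (k * ∑ i, p (u i)) (1 / 16) := by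
    have h4 : 0 ≤ k * ∑ i, p (u i) :=
      mul_nonneg (Nat.cast_nonneg _) (Finset.sum_nonneg fun _ _ => hp _)
    refine le_min (by linarith) ?_
    rw [div_div, div_le_iff₀ (by positivity)]
    nlinarith [mul_nonneg (Nat.cast_nonneg (α := ℝ) k) hX]
  have h5 : n / 2 * ((k : ℝ) * (k - X) / (16 * n) / 1024 / 16) ≤ chainMass p k u :=
    le_trans (by gcongr) hmin
  have h6 : n / 2 * ((k : ℝ) * (k - X) / (16 * n) / 1024 / 16) = k * (k - X) / 2 ^ 19 := by
    field_simp; ring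
  rw [h6, div_le_iff₀ (by norm_num)] at h5
  linarith

/-! ### The halving inequality and its iteration -/

lemma sum_mapWeight_descentWeight (p : V → ℝ) (m : ℕ) :
    ∑ u : Fin (m + 1) → V, (∑ f : V → V, mapWeight p f * descentWeight f (u 0) m u) =
      expectedEndpoints p m := by
  rw [Finset.sum_comm, expectedEndpoints]
  simp only [← Finset.mul_sum, sum_descentWeight]

lemma expectedEndpoints_nonneg (hp : ∀ v, 0 ≤ p v) (k : ℕ) : 0 ≤ expectedEndpoints p k :=
  Finset.sum_nonneg fun f _ => mul_nonneg (mapWeight_nonneg hp f) <|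
    Finset.sum_nonneg fun _ _ => by split_ifs <;> norm_num

lemma expectedEndpoints_le_card (hp : ∀ v, 0 ≤ p v) (h1 : ∑ v, p v = 1) (k : ℕ) :
    expectedEndpoints p k ≤ Fintype.card V := by
  calc expectedEndpoints p k ≤ ∑ f : V → V, mapWeight p f * Fintype.card V := by
        refine Finset.sum_le_sum fun f _ => mul_le_mul_of_nonneg_left ?_ (mapWeight_nonneg hp f)
        rw [Finset.sum_boole]
        exact_mod_cast Finset.card_le_univ _
    _ = _ := by rw [← Finset.sum_mul, sum_mapWeight h1, one_mul]

lemma expectedEndpoints_antitone (hp : ∀ v, 0 ≤ p v) : Antitone (expectedEndpoints p) := by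
  refine antitone_nat_of_succ_le fun k => Finset.sum_le_sum fun f _ =>
    mul_le_mul_of_nonneg_left (Finset.sum_le_sum fun x _ => ?_) (mapWeight_nonneg hp f)
  have h : ReachedAvoiding f x (k + 1) x → ReachedAvoiding f x k x := by
    rintro ⟨v, hv, hav⟩
    exact ⟨f v, hv, fun e he => hav (e + 1) (by lia)⟩
  split_ifs <;> first | tauto | norm_num

lemma expectedEndpoints_add_self_le_distinctProb_mul (hp : ∀ v, 0 ≤ p v) (h1 : ∑ v, p v = 1)
    (k : ℕ) : expectedEndpoints p (k + k) ≤ distinctProb p k * expectedEndpoints p k := by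
  have h := sum_mapWeight_descentWeight_le hp h1 k k
    (fun a => if Function.Injective a then 1 else 0) fun a => by split_ifs <;> norm_num
  simp only [mul_ite, mul_one, mul_zero] at h
  refine le_trans (le_of_eq ?_) h
  rw [← sum_mapWeight_descentWeight, Finset.sum_comm]
  refine Finset.sum_congr rfl fun f _ => ?_
  rw [← Finset.mul_sum]
  congr 1
  refine Finset.sum_congr rfl fun u _ => ?_
  split_ifs with hu
  · rfl
  · by_contra hne
    exact hu ((injective_of_descentWeight_ne_zero hne).comp (Fin.castLE_injective _))

lemma expectedEndpoints_add_self_le_of_distinctProb (hp : ∀ v, 0 ≤ p v) (h1 : ∑ v, p v = 1)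
    {k : ℕ} (hk1 : 1 ≤ k) (hD : 1 / 8 ≤ distinctProb p k) (hk : 8 * k ≤ Fintype.card V) :
    expectedEndpoints p (k + k) ≤
      expectedEndpoints p k / 16 + 2 ^ 22 * (Fintype.card V / k) := by
  have hn : 1 ≤ Fintype.card V := by lia
  have hn0 : (1 : ℝ) ≤ Fintype.card V := Nat.one_le_cast.mpr hn
  have hk0 : (1 : ℝ) ≤ k := Nat.one_le_cast.mpr hk1
  set c : ℝ := 1 / (16 * Fintype.card V) with hc
  have hc0 : 0 ≤ c := by positivity
  set E : (Fin (k + k + 1) → V) → ℝ := fun u =>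
    ∑ f : V → V, mapWeight p f * descentWeight f (u 0) (k + k) u with hE
  have hE0 : ∀ u, 0 ≤ E u := fun u => Finset.sum_nonneg fun f _ =>
    mul_nonneg (mapWeight_nonneg hp f) (descentWeight_nonneg _ _ _ _)
  set X : (Fin (k + k + 1) → V) → ℝ := fun u =>
    lightCount p c fun j : Fin k => u (Fin.castLE (by lia) j) with hX
  have hEX : ∑ u, E u * X u ≤ k / 16 * expectedEndpoints p k := by
    have h2 := sum_mapWeight_descentWeight_le hp h1 k k (lightCount p c) (lightCount_nonneg c)
    have h3 := mul_le_mul_of_nonneg_right (sum_prod_mul_lightCount_le h1 hc0 k)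
      (expectedEndpoints_nonneg hp k)
    have h4 : (k : ℝ) * (c * Fintype.card V) = k / 16 := by rw [hc]; field_simp
    rw [h4] at h3
    refine le_trans (le_of_eq ?_) (h2.trans h3)
    simp only [hE, hX, Finset.sum_mul, Finset.mul_sum]
    rw [Finset.sum_comm]
    exact Finset.sum_congr rfl fun f _ => Finset.sum_congr rfl fun u _ => mul_assoc _ _ _
  have hT : ∑ u, E u * (k * (k - X u)) ≤ 2 ^ 19 * (8 * (k * Fintype.card V)) := by
    have h2 := sum_descentWeight_mul_chainMass_le hp h1 (k + k) k
    calc ∑ u, E u * (k * (k - X u)) ≤ ∑ u, 2 ^ 19 * (E u * chainMass p k u) := by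
          refine Finset.sum_le_sum fun u _ => ?_
          by_cases hu : Function.Injective u
          · have := mul_le_mul_of_nonneg_left
              (mul_sub_lightCount_le_chainMass hp h1 hD hk hn hu) (hE0 u)
            linarith
          · have : E u = 0 := Finset.sum_eq_zero fun f _ => by
              by_contra hne
              exact hu (injective_of_descentWeight_ne_zero (right_ne_zero_of_mul hne))
            simp [this]
      _ ≤ 2 ^ 19 * (2 * (Fintype.card V * ((k + k + k : ℕ) + 1))) := by
          rw [← Finset.mul_sum]
          gcongr
      _ ≤ _ := by
          push_cast
          nlinarith
  have hsum : ∑ u, E u * (k * (k - X u)) =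
      k * (k * expectedEndpoints p (k + k) - ∑ u, E u * X u) := by
    rw [← sum_mapWeight_descentWeight, Finset.mul_sum, ← Finset.sum_sub_distrib, Finset.mul_sum]
    exact Finset.sum_congr rfl fun u _ => by ring
  rw [hsum] at hT
  have h5 : k * expectedEndpoints p (k + k) - ∑ u, E u * X u ≤ 2 ^ 22 * Fintype.card V := by
    refine le_of_mul_le_mul_left (hT.trans (le_of_eq ?_)) (zero_lt_one.trans_le hk0)
    ring
  have h6 : k * expectedEndpoints p (k + k) ≤
      k * (expectedEndpoints p k / 16 + 2 ^ 22 * (Fintype.card V / k)) := by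
    have : (k : ℝ) * (expectedEndpoints p k / 16 + 2 ^ 22 * (Fintype.card V / k)) =
        k / 16 * expectedEndpoints p k + 2 ^ 22 * Fintype.card V := by field_simp
    linarith
  exact le_of_mul_le_mul_left h6 (zero_lt_one.trans_le hk0)

lemma expectedEndpoints_add_self_le (hp : ∀ v, 0 ≤ p v) (h1 : ∑ v, p v = 1)
    (hn : 1 ≤ Fintype.card V) {k : ℕ} (hk1 : 1 ≤ k) :
    expectedEndpoints p (k + k) ≤
      expectedEndpoints p k / 8 + 2 ^ 22 * (Fintype.card V / k) := by
  have hk0 : (1 : ℝ) ≤ k := Nat.one_le_cast.mpr hk1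
  have hN := expectedEndpoints_nonneg hp k
  have h0 : (0 : ℝ) ≤ Fintype.card V / k := by positivity
  rcases lt_or_ge (distinctProb p k) (1 / 8) with hD | hD
  · have h2 := expectedEndpoints_add_self_le_distinctProb_mul hp h1 k
    have h3 := mul_le_mul_of_nonneg_right hD.le hN
    linarith
  · rcases le_or_gt (8 * k) (Fintype.card V) with hk | hk
    · have := expectedEndpoints_add_self_le_of_distinctProb hp h1 hk1 hD hk
      linarith
    · have hsq := sq_le_of_le_distinctProb hp h1 hn hD
      have hk' : (Fintype.card V : ℝ) ≤ 8 * k := by exact_mod_cast hk.le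
      have h2 : (k : ℝ) ≤ 2 ^ 22 := by nlinarith
      have h3 := expectedEndpoints_le_card hp h1 (k + k)
      have h4 : (Fintype.card V : ℝ) ≤ 2 ^ 22 * (Fintype.card V / k) := by
        rw [mul_div_assoc', le_div_iff₀ (by positivity), mul_comm]
        gcongr
      linarith

lemma mul_expectedEndpoints_le (hp : ∀ v, 0 ≤ p v) (h1 : ∑ v, p v = 1)
    (hn : 1 ≤ Fintype.card V) (K : ℕ) :
    K * expectedEndpoints p K ≤ 2 ^ 25 * Fintype.card V := by
  induction K using Nat.strong_induction_on with
  | _ K ih =>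
    have hK0 : (0 : ℝ) ≤ expectedEndpoints p K := expectedEndpoints_nonneg hp K
    have hcard := expectedEndpoints_le_card hp h1 K
    rcases lt_or_ge K 2 with h | h
    · have hK1 : (K : ℝ) ≤ 1 := by exact_mod_cast Nat.lt_succ_iff.mp h
      nlinarith
    · set k := K / 2 with hk
      have hk1 : 1 ≤ k := by lia
      have hk0 : (1 : ℝ) ≤ k := Nat.one_le_cast.mpr hk1
      have h2 := expectedEndpoints_add_self_le hp h1 hn hk1
      have h3 : expectedEndpoints p K ≤ expectedEndpoints p (k + k) :=
        expectedEndpoints_antitone hp (by lia)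
      have h4 := ih k (by lia)
      have h5 : (K : ℝ) ≤ 3 * k := by exact_mod_cast (by lia : K ≤ 3 * k)
      have h6 : (k : ℝ) * (expectedEndpoints p k / 8 + 2 ^ 22 * (Fintype.card V / k)) =
          k * expectedEndpoints p k / 8 + 2 ^ 22 * Fintype.card V := by field_simp
      calc (K : ℝ) * expectedEndpoints p K ≤ 3 * k * expectedEndpoints p K := by gcongr
        _ ≤ 3 * (k * (expectedEndpoints p k / 8 + 2 ^ 22 * (Fintype.card V / k))) := by
            rw [mul_assoc]
            gcongr
            exact h3.trans h2
        _ ≤ _ := by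
            rw [h6]
            have : (0 : ℝ) ≤ Fintype.card V := Nat.cast_nonneg _
            linarith

omit [Fintype V] in
lemma IsPathEndpoint.reachedAvoiding {f : V → V} {k : ℕ} {x : V} (h : IsPathEndpoint f k x) :
    ReachedAvoiding f x k x := by
  obtain ⟨v, hinj, hf, rfl⟩ := h
  have hv : ∀ e (he : e < k + 1), f^[e] (v 0) = v ⟨e, he⟩ := by
    intro e
    induction e with
    | zero => intro _; rfl
    | succ e ih =>
      intro he
      rw [Function.iterate_succ_apply', ih (by lia)]
      exact hf ⟨e, by lia⟩
  refine ⟨v 0, hv k (by lia), fun e he heq => ?_⟩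
  rw [hv e (by lia)] at heq
  have := congrArg Fin.val (hinj heq)
  simp only [Fin.val_last] at this
  lia

end

/-- For a random function `f : Fin n → Fin n` with independent
values distributed according to a probability vector `(p_v)`, the expected
number of endpoints of directed paths of length `k` is `O(n/k)`, uniformly in
`n`, `k` and the probability vector. -/
theorem expected_path_endpoints_le :
    ∃ C : ℝ, 0 < C ∧ ∀ n : ℕ, 1 ≤ n →
      ∀ p : Fin n → ℝ, (∀ v, 0 ≤ p v) → (∑ v, p v) = 1 →
        ∀ k : ℕ, 1 ≤ k →
          ∑ f : Fin n → Fin n, (∏ v, p (f v)) *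
              ((Finset.univ.filter (fun x : Fin n => IsPathEndpoint f k x)).card : ℝ)
            ≤ C * n / k := by
  refine ⟨2 ^ 25, by positivity, fun n hn p hp h1 k hk => ?_⟩
  have hmain := mul_expectedEndpoints_le hp h1 (by simpa using hn) k
  rw [Fintype.card_fin] at hmain
  have hk0 : (0 : ℝ) < k := Nat.cast_pos.mpr hk
  rw [le_div_iff₀ hk0, mul_comm]
  refine le_trans ?_ hmain
  gcongr
  calc _ ≤ ∑ f : Fin n → Fin n, mapWeight p f *
        ∑ x, if ReachedAvoiding f x k x then (1 : ℝ) else 0 := by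
        refine Finset.sum_le_sum fun f _ => mul_le_mul_of_nonneg_left ?_ (mapWeight_nonneg hp f)
        rw [Finset.sum_boole, Nat.cast_le]
        exact Finset.card_le_card (Finset.monotone_filter_right _ fun x _ hx => hx.reachedAvoiding)
    _ = _ := by
        unfold expectedEndpoints
        convert rfl
end

section
/- Fix n ≥ 1 and a vertex set V of size n. Among all probability vectors (p_v)_{v∈V}, the uniform vector (1/n, …, 1/n) maximizes the expected number of cyclic vertices of a random function f : V → V whose values f(v) are independent with distribution (p_v). That is, for every probability vector (p_v)_{v∈V}, the expected number of cyclic vertices under (p_v) is at most the expected number of cyclic vertices when each f(v) is uniform on V. -/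
open scoped BigOperators Classical

open Finset Function

section CyclicVertices

/-- Iterating a function along a cyclically ordered orbit follows that orbit. -/
lemma iterate_eq_of_cycle {V : Type*} {f : V → V} {m : ℕ} {s : Fin (m + 1) → V}
    (hs : ∀ i, f (s i) = s (i + 1)) (j : ℕ) : f^[j] (s 0) = s (Fin.ofNat (m + 1) j) := by
  induction j with
  | zero => rfl
  | succ j ih =>
    rw [iterate_succ_apply', ih, hs]
    congr 1
    ext
    simp [Fin.val_add]

lemma minimalPeriod_of_cycle {V : Type*} {f : V → V} {m : ℕ} (s : Fin (m + 1) ↪ V)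
    (hs : ∀ i, f (s i) = s (i + 1)) : minimalPeriod f (s 0) = m + 1 := by
  have hper : IsPeriodicPt f (m + 1) (s 0) := by
    refine (iterate_eq_of_cycle hs (m + 1)).trans ?_
    congr 1
    ext
    simp
  apply le_antisymm (hper.minimalPeriod_le m.succ_pos)
  have hpos := hper.minimalPeriod_pos m.succ_pos
  have h := (iterate_eq_of_cycle hs _).symm.trans (iterate_minimalPeriod (f := f) (x := s 0))
  have h' := congrArg Fin.val (s.injective h)
  exact Nat.le_of_dvd hpos (Nat.dvd_of_mod_eq_zero (by simpa using h'))

variable {V : Type*} [Fintype V]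

/-- Points of minimal period `m + 1` correspond to injective cyclic orbits of length `m + 1`. -/
lemma card_minimalPeriod_eq (f : V → V) (m : ℕ) :
    #{x | minimalPeriod f x = m + 1} =
      #{s : Fin (m + 1) ↪ V | ∀ i, f (s i) = s (i + 1)} := by
  symm
  refine Finset.card_bij (fun s _ => s 0) ?_ ?_ ?_
  · intro s hs
    simp only [mem_filter, mem_univ, true_and] at hs ⊢
    exact minimalPeriod_of_cycle s hs
  · intro s hs t ht hst
    simp only [mem_filter, mem_univ, true_and] at hs ht
    ext i
    have h1 := iterate_eq_of_cycle hs i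
    have h2 := iterate_eq_of_cycle ht i
    rw [hst, h2] at h1
    simpa using h1.symm
  · intro x hx
    simp only [mem_filter, mem_univ, true_and] at hx
    refine ⟨⟨fun i => f^[i] x, fun i j hij => ?_⟩, ?_, rfl⟩
    · exact Fin.ext ((iterate_eq_iterate_iff_of_lt_minimalPeriod
        (by rw [hx]; exact i.2) (by rw [hx]; exact j.2)).1 hij)
    · simp only [mem_filter, mem_univ, true_and]
      intro i
      change f (f^[i] x) = f^[(i + 1 : Fin (m + 1))] x
      rw [← iterate_succ_apply' f, ← iterate_mod_minimalPeriod_eq (n := (i : ℕ).succ), hx]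
      simp only [Fin.val_add, Fin.val_one', Nat.add_mod_mod, Nat.succ_eq_add_one]

lemma minimalPeriod_le_card (f : V → V) (x : V) : minimalPeriod f x ≤ Fintype.card V := by
  have h := Finset.card_le_card_of_injOn (s := range (minimalPeriod f x)) (t := univ)
    (f^[·] x) (fun _ _ => mem_coe.2 (mem_univ _))
    (by simpa using iterate_injOn_Iio_minimalPeriod (f := f) (x := x))
  simpa using h

lemma card_cyclic_eq (f : V → V) :
    #{x : V | ∃ t : ℕ, 1 ≤ t ∧ f^[t] x = x} =
      ∑ m ∈ range (Fintype.card V), #{s : Fin (m + 1) ↪ V | ∀ i, f (s i) = s (i + 1)} := by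
  simp_rw [← card_minimalPeriod_eq]
  rw [← Finset.card_biUnion]
  · congr 1
    ext x
    simp only [mem_filter, mem_univ, true_and, mem_biUnion, mem_range]
    constructor
    · rintro ⟨t, ht, hx⟩
      have h1 := IsPeriodicPt.minimalPeriod_pos ht hx
      have h2 := minimalPeriod_le_card f x
      exact ⟨minimalPeriod f x - 1, by omega, by omega⟩
    · rintro ⟨m, -, hm⟩
      exact ⟨minimalPeriod f x, by omega, iterate_minimalPeriod⟩
  · intro a _ b _ hab
    refine disjoint_left.2 fun x hx hx' => hab ?_
    simp only [mem_filter, mem_univ, true_and] at hx hx'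
    omega

/-- Probability that a random function takes prescribed values at distinct points. -/
lemma sum_prod_mul_indicator {ι : Type*} [Fintype ι] (p : V → ℝ) (hsum : ∑ v, p v = 1)
    (s : ι ↪ V) (t : ι → V) :
    ∑ f : V → V, (∏ v, p (f v)) * (if ∀ i, f (s i) = t i then 1 else 0) = ∏ i, p (t i) := by
  have h (f : V → V) : (∏ v, p (f v)) * (if ∀ i, f (s i) = t i then 1 else 0) =
      ∏ v, p (f v) * (if ∀ i, s i = v → f v = t i then 1 else 0) := by
    rw [prod_mul_distrib, Fintype.prod_boole]
    congr 2
    exact propext ⟨by rintro h _ i rfl; exact h i, fun h i => h _ i rfl⟩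
  simp_rw [h]
  rw [← Fintype.prod_sum (fun v w => p w * (if ∀ i, s i = v → w = t i then 1 else 0))]
  symm
  apply Fintype.prod_of_injective s s.injective
  · intro v hv
    have hv' : ∀ i, s i ≠ v := fun i hi => hv ⟨i, hi⟩
    simp [hv', hsum]
  · intro i
    simp

/-- The sum over injective sequences of length `k` of the product of the weights, that is, `k!`
times the `k`-th elementary symmetric polynomial. -/
noncomputable def injectiveWeight (p : V → ℝ) (k : ℕ) : ℝ :=
  ∑ s : Fin k ↪ V, ∏ i, p (s i)

lemma expected_cyclic_eq (p : V → ℝ) (hsum : ∑ v, p v = 1) :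
    ∑ f : V → V, (∏ v, p (f v)) * (#{x : V | ∃ t : ℕ, 1 ≤ t ∧ f^[t] x = x} : ℝ) =
      ∑ m ∈ range (Fintype.card V), injectiveWeight p (m + 1) := by
  simp_rw [card_cyclic_eq, Nat.cast_sum, mul_sum]
  rw [sum_comm]
  refine sum_congr rfl fun m _ => ?_
  simp_rw [card_filter, Nat.cast_sum, mul_sum]
  rw [sum_comm, injectiveWeight]
  refine sum_congr rfl fun s _ => ?_
  push_cast
  rw [← Equiv.prod_comp (Equiv.addRight (1 : Fin (m + 1))) (fun i => p (s i))]
  convert sum_prod_mul_indicator p hsum s (fun i => s (i + 1))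
  rfl

lemma sum_embedding_succ (k : ℕ) (G : V → (Fin k → V) → ℝ) :
    ∑ s : Fin (k + 1) ↪ V, G (s 0) (s ∘ Fin.succ) =
      ∑ e : Fin k ↪ V, ∑ i with i ∉ Set.range e, G i e := by
  refine (Fintype.sum_equiv (Equiv.embeddingFinSucc k V) _
    (fun x => G x.2 x.1) (fun _ => rfl)).trans ?_
  rw [Fintype.sum_sigma]
  refine sum_congr rfl fun e _ => ?_
  exact (sum_subtype _ (by simp) (fun i => G i e)).symm

lemma injectiveWeight_succ (p : V → ℝ) (k : ℕ) :
    injectiveWeight p (k + 1) =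
      ∑ e : Fin k ↪ V, (∏ i, p (e i)) * ∑ i with i ∉ Set.range e, p i := by
  simp_rw [injectiveWeight, Fin.prod_univ_succ, mul_sum]
  rw [← sum_embedding_succ k (fun i e => (∏ j, p (e j)) * p i)]
  exact sum_congr rfl fun s _ => mul_comm _ _

lemma filter_notMem_range_sum {k : ℕ} (e : Fin k ↪ V) (q : V → ℝ) :
    ∑ i with i ∉ Set.range e, q i = ∑ i, q i - ∑ j, q (e j) := by
  have h : ∑ i with i ∈ Set.range e, q i = ∑ j, q (e j) := by
    rw [← sum_map univ e q]
    congr 1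
    ext
    simp
  rw [← h, ← sum_filter_add_sum_filter_not univ (fun i => i ∈ Set.range e)]
  ring

lemma injectiveWeight_one (p : V → ℝ) : injectiveWeight p 1 = ∑ v, p v := by
  simp [injectiveWeight_succ]

lemma sum_prod_mul_apply_eq (p : V → ℝ) (k : ℕ) (j : Fin (k + 1)) :
    ∑ s : Fin (k + 1) ↪ V, (∏ i, p (s i)) * p (s j) =
      ∑ e : Fin k ↪ V, (∏ i, p (e i)) * ∑ i with i ∉ Set.range e, p i ^ 2 := by
  simp_rw [mul_sum]
  rw [← sum_embedding_succ k (fun i e => (∏ j, p (e j)) * p i ^ 2)]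
  refine Fintype.sum_equiv ((Equiv.swap 0 j).embeddingCongr (Equiv.refl V)) _ _ fun s => ?_
  have h (i : Fin (k + 1)) :
      (Equiv.swap 0 j).embeddingCongr (Equiv.refl V) s i = s (Equiv.swap 0 j i) := rfl
  have hprod := Fin.prod_univ_succ fun i => p (s (Equiv.swap 0 j i))
  rw [Equiv.prod_comp (Equiv.swap 0 j) (fun i => p (s i)), Equiv.swap_apply_left] at hprod
  simp only [Function.comp_apply, h, Equiv.swap_apply_left, hprod]
  ring

lemma injectiveWeight_eq_succ_add (p : V → ℝ) (hsum : ∑ v, p v = 1) (k : ℕ) :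
    injectiveWeight p (k + 1) = injectiveWeight p (k + 2) +
      (k + 1) * ∑ e : Fin k ↪ V, (∏ i, p (e i)) * ∑ i with i ∉ Set.range e, p i ^ 2 := by
  have h : ∑ j : Fin (k + 1), ∑ s : Fin (k + 1) ↪ V, (∏ i, p (s i)) * p (s j) =
      (k + 1) * ∑ e : Fin k ↪ V, (∏ i, p (e i)) * ∑ i with i ∉ Set.range e, p i ^ 2 := by
    simp [sum_prod_mul_apply_eq]
  rw [← h, sum_comm, injectiveWeight_succ p (k + 1), injectiveWeight, ← sum_add_distrib]
  refine sum_congr rfl fun s _ => ?_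
  rw [filter_notMem_range_sum, hsum, ← mul_sum]
  ring

lemma injectiveWeight_add_two_eq (p : V → ℝ) (k : ℕ) :
    injectiveWeight p (k + 2) = ∑ e : Fin k ↪ V, (∏ i, p (e i)) *
      ((∑ i with i ∉ Set.range e, p i) ^ 2 - ∑ i with i ∉ Set.range e, p i ^ 2) := by
  have h := sum_embedding_succ k (fun a (e : Fin k → V) =>
    p a * (∏ j, p (e j)) * (∑ v, p v - (p a + ∑ j, p (e j))))
  rw [injectiveWeight_succ]
  simp_rw [filter_notMem_range_sum _ p, Fin.prod_univ_succ, Fin.sum_univ_succ]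
  refine h.trans (sum_congr rfl fun e _ => ?_)
  rw [← filter_notMem_range_sum, sq, sum_mul, ← sum_sub_distrib, mul_sum]
  refine sum_congr rfl fun a _ => ?_
  rw [filter_notMem_range_sum]
  ring

lemma card_filter_notMem_range {k : ℕ} (e : Fin k ↪ V) :
    (#{i | i ∉ Set.range e} : ℝ) = Fintype.card V - k := by
  simpa using filter_notMem_range_sum e (fun _ => 1)

lemma injectiveWeight_add_two_le (p : V → ℝ) (hp : ∀ v, 0 ≤ p v) (k : ℕ) :
    injectiveWeight p (k + 2) ≤ (Fintype.card V - k - 1) *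
      ∑ e : Fin k ↪ V, (∏ i, p (e i)) * ∑ i with i ∉ Set.range e, p i ^ 2 := by
  rw [injectiveWeight_add_two_eq, mul_sum]
  refine sum_le_sum fun e _ => ?_
  rw [mul_left_comm]
  refine mul_le_mul_of_nonneg_left ?_ (prod_nonneg fun i _ => hp _)
  have h := sq_sum_le_card_mul_sum_sq (s := {i | i ∉ Set.range e}) (f := p)
  rw [card_filter_notMem_range] at h
  linarith

/-- One step of Maclaurin's inequality. -/
lemma card_mul_injectiveWeight_le (p : V → ℝ) (hp : ∀ v, 0 ≤ p v) (hsum : ∑ v, p v = 1) (k : ℕ) :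
    Fintype.card V * injectiveWeight p (k + 2) ≤
      (Fintype.card V - (k + 1)) * injectiveWeight p (k + 1) := by
  have h1 := injectiveWeight_eq_succ_add p hsum k
  have h2 := mul_le_mul_of_nonneg_left (injectiveWeight_add_two_le p hp k)
    (by positivity : (0 : ℝ) ≤ k + 1)
  rw [h1]
  linarith

lemma pow_mul_injectiveWeight_le (p : V → ℝ) (hp : ∀ v, 0 ≤ p v) (hsum : ∑ v, p v = 1) (k : ℕ)
    (hk : k < Fintype.card V) :
    (Fintype.card V : ℝ) ^ (k + 1) * injectiveWeight p (k + 1) ≤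
      (Fintype.card V).descFactorial (k + 1) := by
  induction k with
  | zero => simp [injectiveWeight_one, hsum]
  | succ k ih =>
    have hcast : ((Fintype.card V - (k + 1) : ℕ) : ℝ) = Fintype.card V - (k + 1) := by
      rw [Nat.cast_sub hk.le]
      push_cast
      rfl
    rw [Nat.descFactorial_succ, Nat.cast_mul, pow_succ, mul_assoc, hcast]
    calc _ ≤ (Fintype.card V : ℝ) ^ (k + 1) *
          ((Fintype.card V - (k + 1)) * injectiveWeight p (k + 1)) :=
          mul_le_mul_of_nonneg_left (card_mul_injectiveWeight_le p hp hsum k) (by positivity)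
      _ = (Fintype.card V - (k + 1)) *
          ((Fintype.card V : ℝ) ^ (k + 1) * injectiveWeight p (k + 1)) := by ring
      _ ≤ _ := mul_le_mul_of_nonneg_left (ih (by omega)) (hcast ▸ Nat.cast_nonneg _)

lemma injectiveWeight_const (c : ℝ) (k : ℕ) :
    injectiveWeight (fun _ : V => c) k = (Fintype.card V).descFactorial k * c ^ k := by
  simp [injectiveWeight, Fintype.card_embedding_eq]

end CyclicVertices

/-- Among all probability vectors `(p_v)` on a vertex set `V` of
size `n ≥ 1`, the uniform vector maximizes the expected number of cyclic
vertices of a random function `f : V → V` with independent values distributed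
according to `(p_v)`. -/
theorem uniform_maximizes_expected_cyclic
    {V : Type*} [Fintype V] (n : ℕ) (hn : 1 ≤ n) (hcard : Fintype.card V = n)
    (p : V → ℝ) (hp : ∀ v, 0 ≤ p v) (hsum : (∑ v, p v) = 1) :
    ∑ f : V → V, (∏ v, p (f v)) *
        ((Finset.univ.filter (fun x : V => ∃ t : ℕ, 1 ≤ t ∧ f^[t] x = x)).card : ℝ)
      ≤ ∑ f : V → V, (∏ _v : V, (1 / n : ℝ)) *
          ((Finset.univ.filter (fun x : V => ∃ t : ℕ, 1 ≤ t ∧ f^[t] x = x)).card : ℝ) := by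
  subst hcard
  have hpos : (0 : ℝ) < Fintype.card V := by exact_mod_cast hn
  have hunif : ∑ _v : V, (1 / Fintype.card V : ℝ) = 1 := by
    simp [hpos.ne']
  rw [expected_cyclic_eq p hsum, expected_cyclic_eq (fun _ => (1 / Fintype.card V : ℝ)) hunif]
  refine Finset.sum_le_sum fun k hk => ?_
  rw [injectiveWeight_const, one_div, inv_pow, ← div_eq_mul_inv, le_div_iff₀' (pow_pos hpos _)]
  exact pow_mul_injectiveWeight_le p hp hsum k (Finset.mem_range.1 hk)
end

section
/- Let V be a finite set, let (p_v)_{v∈V} be a probability vector, and let f : V → V be a random function whose values f(v) are independent, each distributed according to (p_v). Then the expected number of cyclic vertices of f equals Σ_{∅ ≠ C ⊆ V} |C|! · Π_{y∈C} p_y, where the sum is over all nonempty subsets C of V. -/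
open scoped BigOperators Classical

/-- The total weight of the functions whose values on the range of `e` are prescribed by `g`. -/
lemma sum_prod_of_prescribed_values {V ι : Type*} [Fintype V] [Fintype ι]
    (p : V → ℝ) (hsum : ∑ v, p v = 1) (e : ι ↪ V) (g : ι → V) :
    ∑ f : V → V with ∀ i, f (e i) = g i, ∏ v, p (f v) = ∏ i, p (g i) := by
  set s : V → Finset V := fun v => Finset.univ.filter fun y => ∀ i, e i = v → y = g i with hs
  have hset : (Finset.univ.filter fun f : V → V => ∀ i, f (e i) = g i) = Fintype.piFinset s := by
    ext f
    simp only [hs, Finset.mem_filter, Finset.mem_univ, true_and, Fintype.mem_piFinset]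
    exact ⟨fun h v i hi => hi ▸ h i, fun h i => h _ i rfl⟩
  rw [hset, ← Finset.prod_univ_sum s fun _ y => p y]
  have hout : ∀ v ∈ Finset.univ, v ∉ Finset.univ.map e → ∑ y ∈ s v, p y = 1 := by
    intro v _ hv
    have : s v = Finset.univ := by
      ext y
      simp only [hs, Finset.mem_filter, Finset.mem_univ, true_and, iff_true]
      intro i hi
      exact absurd (by simp [← hi]) hv
    rw [this, hsum]
  rw [← Finset.prod_subset (Finset.subset_univ (Finset.univ.map e)) hout, Finset.prod_map]
  refine Finset.prod_congr rfl fun i _ => ?_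
  have : s (e i) = {g i} := by
    ext y
    simp only [hs, Finset.mem_filter, Finset.mem_univ, true_and, Finset.mem_singleton]
    exact ⟨fun h => h i rfl, fun h j hj => e.injective hj ▸ h⟩
  rw [this, Finset.sum_singleton]

/-- Points of minimal period `m + 1` correspond to parametrised cycles of length `m + 1`. -/
lemma card_minimalPeriod_eq_s7 {V : Type*} [Fintype V] (f : V → V) (m : ℕ) :
    (Finset.univ.filter fun x => Function.minimalPeriod f x = m + 1).card =
      (Finset.univ.filter fun e : Fin (m + 1) ↪ V =>
        ∀ i, f (e i) = e (finRotate (m + 1) i)).card := by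
  have key : ∀ e : Fin (m + 1) ↪ V, (∀ i, f (e i) = e (finRotate (m + 1) i)) →
      ∀ k (hk : k < m + 1), f^[k] (e 0) = e ⟨k, hk⟩ := by
    intro e he k
    induction k with
    | zero => intro _; rfl
    | succ k ih =>
      intro hk
      rw [Function.iterate_succ_apply', ih (by omega), he, finRotate_of_lt (by omega)]
  symm
  refine Finset.card_bij (fun e _ => e 0) ?_ ?_ ?_
  · intro e he
    simp only [Finset.mem_filter, Finset.mem_univ, true_and] at he ⊢
    have hper : Function.IsPeriodicPt f (m + 1) (e 0) := by
      change f^[m + 1] (e 0) = e 0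
      rw [Function.iterate_succ_apply', key e he m (by omega), he]
      congr 1
      exact finRotate_last'
    refine le_antisymm (hper.minimalPeriod_le (by omega)) (not_lt.1 fun hlt => ?_)
    have h0 := key e he _ hlt
    rw [Function.iterate_minimalPeriod] at h0
    have h1 := congrArg Fin.val (e.injective h0)
    have := hper.minimalPeriod_pos (by omega)
    simp at h1
    omega
  · intro e he e' he' h
    simp only [Finset.mem_filter, Finset.mem_univ, true_and] at he he'
    ext i
    rw [← key e he i i.2, ← key e' he' i i.2]
    exact congrArg _ h
  · intro x hx
    simp only [Finset.mem_filter, Finset.mem_univ, true_and] at hx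
    have hinj : Function.Injective fun i : Fin (m + 1) => f^[i] x := fun i j hij =>
      Fin.ext (Function.iterate_injOn_Iio_minimalPeriod
        (i.2.trans_eq hx.symm) (j.2.trans_eq hx.symm) hij)
    refine ⟨⟨_, hinj⟩, ?_, rfl⟩
    simp only [Finset.mem_filter, Finset.mem_univ, true_and]
    intro i
    change f (f^[i] x) = f^[(finRotate (m + 1) i : ℕ)] x
    rw [← Function.iterate_succ_apply' f, coe_finRotate]
    split_ifs with h
    · rw [h, Fin.val_last, Nat.succ_eq_add_one, ← hx, Function.iterate_minimalPeriod]
      rfl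
    · rfl

/-- The cyclic points of `f`, sorted by the length of their cycle. -/
lemma card_cyclic_eq_sum {V : Type*} [Fintype V] (f : V → V) :
    (Finset.univ.filter fun x : V => ∃ t : ℕ, 1 ≤ t ∧ f^[t] x = x).card =
      ∑ m ∈ Finset.range (Fintype.card V),
        (Finset.univ.filter fun e : Fin (m + 1) ↪ V =>
          ∀ i, f (e i) = e (finRotate (m + 1) i)).card := by
  have hcyc : ∀ x, (∃ t : ℕ, 1 ≤ t ∧ f^[t] x = x) ↔ 0 < Function.minimalPeriod f x := fun x =>
    Function.minimalPeriod_pos_iff_mem_periodicPts.symm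
  have hle : ∀ x, Function.minimalPeriod f x ≤ Fintype.card V := by
    intro x
    have := Fintype.card_le_of_injective
      (fun i : Fin (Function.minimalPeriod f x) => f^[i] x) fun i j hij =>
        Fin.ext (Function.iterate_injOn_Iio_minimalPeriod i.2 j.2 hij)
    simpa using this
  rw [Finset.card_eq_sum_card_fiberwise (f := fun x => Function.minimalPeriod f x - 1)
    (t := Finset.range (Fintype.card V))]
  · refine Finset.sum_congr rfl fun m _ => ?_
    rw [← card_minimalPeriod_eq_s7, Finset.filter_filter]
    congr 1
    ext x
    simp only [Finset.mem_filter, Finset.mem_univ, true_and, hcyc]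
    omega
  · intro x hx
    have h1 : 0 < Function.minimalPeriod f x := by simpa [hcyc] using hx
    have := hle x
    simp only [Finset.coe_range, Set.mem_Iio]
    omega

/-- Each `n`-element set is the range of exactly `n!` embeddings of `Fin n`. -/
lemma card_embedding_map_univ_eq {V : Type*} [Fintype V] (n : ℕ) (C : Finset V) (hC : C.card = n) :
    (Finset.univ.filter fun e : Fin n ↪ V => Finset.univ.map e = C).card = n.factorial := by
  have hcard : Fintype.card (Fin n ≃ C) = n.factorial := by
    rw [Fintype.card_equiv (Fintype.equivOfCardEq (by simp [hC])), Fintype.card_fin]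
  rw [← hcard, ← Finset.card_univ]
  symm
  refine Finset.card_bij (fun σ _ => σ.toEmbedding.trans (Function.Embedding.subtype _)) ?_ ?_ ?_
  · intro σ _
    simp only [Finset.mem_filter, Finset.mem_univ, true_and]
    refine Finset.eq_of_subset_of_card_le (fun x hx => ?_) (by simp [hC])
    obtain ⟨i, -, rfl⟩ := Finset.mem_map.1 hx
    exact (σ i).2
  · intro σ _ τ _ h
    ext i
    exact DFunLike.congr_fun h i
  · intro e he
    have he : Finset.univ.map e = C := by simpa using he
    have hmem : ∀ i, e i ∈ C := fun i => he ▸ Finset.mem_map_of_mem e (Finset.mem_univ i)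
    refine ⟨Equiv.ofBijective (fun i => ⟨e i, hmem i⟩) ⟨fun i j hij => ?_, fun y => ?_⟩,
      Finset.mem_univ _, rfl⟩
    · exact e.injective (congrArg Subtype.val hij)
    · obtain ⟨i, -, hi⟩ := Finset.mem_map.1 (he.ge y.2)
      exact ⟨i, Subtype.ext hi⟩

/-- Summing a product weight over embeddings amounts to summing it over their ranges. -/
lemma sum_embedding_prod_eq {V : Type*} [Fintype V] (p : V → ℝ) (n : ℕ) :
    ∑ e : Fin n ↪ V, ∏ i, p (e i) =
      ∑ C ∈ Finset.univ.powersetCard n, (C.card.factorial : ℝ) * ∏ y ∈ C, p y := by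
  rw [← Finset.sum_fiberwise_of_maps_to (g := fun e : Fin n ↪ V => Finset.univ.map e)
    (t := Finset.univ.powersetCard n) (by simp)]
  refine Finset.sum_congr rfl fun C hC => ?_
  have hn : C.card = n := (Finset.mem_powersetCard.1 hC).2
  rw [hn, ← card_embedding_map_univ_eq n C hn, ← nsmul_eq_mul, ← Finset.sum_const]
  refine Finset.sum_congr rfl fun e he => ?_
  rw [← (Finset.mem_filter.1 he).2, Finset.prod_map]

/-- For a random function `f : V → V` with independent values
distributed according to a probability vector `(p_v)`, the expected number of
cyclic vertices equals `Σ_{∅ ≠ C ⊆ V} |C|!·Π_{y∈C} p_y`. -/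
theorem expected_cyclic_eq_sum_over_subsets
    {V : Type*} [Fintype V]
    (p : V → ℝ) (hp : ∀ v, 0 ≤ p v) (hsum : (∑ v, p v) = 1) :
    ∑ f : V → V, (∏ v, p (f v)) *
        ((Finset.univ.filter (fun x : V => ∃ t : ℕ, 1 ≤ t ∧ f^[t] x = x)).card : ℝ)
      = ∑ C ∈ Finset.univ.powerset.filter (fun C : Finset V => C.Nonempty),
          (C.card.factorial : ℝ) * ∏ y ∈ C, p y := by
  have hcycle : ∀ m, ∑ f : V → V, (∏ v, p (f v)) *
      ((Finset.univ.filter fun e : Fin (m + 1) ↪ V =>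
        ∀ i, f (e i) = e (finRotate (m + 1) i)).card : ℝ) =
      ∑ C ∈ Finset.univ.powersetCard (m + 1), (C.card.factorial : ℝ) * ∏ y ∈ C, p y := by
    intro m
    rw [← sum_embedding_prod_eq]
    simp_rw [Finset.card_filter, Nat.cast_sum, Finset.mul_sum]
    rw [Finset.sum_comm]
    refine Finset.sum_congr rfl fun e _ => ?_
    rw [← Equiv.prod_comp (finRotate (m + 1)) fun i => p (e i),
      ← sum_prod_of_prescribed_values p hsum e, Finset.sum_filter]
    simp
  have hlevels : Finset.univ.powerset.filter (fun C : Finset V => C.Nonempty) =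
      (Finset.range (Fintype.card V)).biUnion fun m => Finset.univ.powersetCard (m + 1) := by
    ext C
    have := Finset.card_le_univ C
    simp only [Finset.mem_filter, Finset.mem_powerset, Finset.subset_univ, true_and,
      Finset.mem_biUnion, Finset.mem_range, Finset.mem_powersetCard, ← Finset.card_pos]
    exact ⟨fun h => ⟨C.card - 1, by omega, by omega⟩, fun ⟨m, _, h⟩ => by omega⟩
  rw [hlevels, Finset.sum_biUnion]
  · simp_rw [card_cyclic_eq_sum, Nat.cast_sum, Finset.mul_sum]
    rw [Finset.sum_comm]
    exact Finset.sum_congr rfl fun m _ => hcycle m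
  · intro m _ k _ hmk
    exact Finset.pairwise_disjoint_powersetCard _ (by simpa using hmk)
end

section
/- Define the sequence (q_k)_{k≥0} of reals by q₀ = 0 and q_{k+1} = exp(−(1−q_k)). Then 0 ≤ q_k ≤ 1 for all k, and there exists a constant C > 0 such that q_k ≥ 1 − C/k for all k ≥ 1; that is, q_k = 1 − O(1/k). -/
/-- The extinction probabilities of a Galton–Watson process with Poisson(1)
offspring: `q 0 = 0` and `q (k+1) = exp(−(1 − q k))`. -/
noncomputable def q : ℕ → ℝ
  | 0 => 0
  | k + 1 => Real.exp (-(1 - q k))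

theorem q_mem_Icc (k : ℕ) : 0 ≤ q k ∧ q k ≤ 1 := by
  induction k with
  | zero => simp [q]
  | succ k ih =>
    simp only [q]
    exact ⟨(Real.exp_pos _).le, Real.exp_le_one_iff.mpr (by linarith [ih.2])⟩

theorem one_sub_half_sq_le_exp_neg {x : ℝ} (hx : x ≤ 2) :
    (1 - x / 2) ^ 2 ≤ Real.exp (-x) := by
  have h : 1 - x / 2 ≤ Real.exp (-(x / 2)) := Real.one_sub_le_exp_neg _
  calc (1 - x / 2) ^ 2 ≤ Real.exp (-(x / 2)) ^ 2 :=
        pow_le_pow_left₀ (by linarith) h 2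
    _ = Real.exp (-x) := by
        rw [← Real.exp_nat_mul]
        congr 1
        push_cast
        ring

theorem one_sub_four_div_add_four_le_q (k : ℕ) : 1 - 4 / ((k : ℝ) + 4) ≤ q k := by
  induction k with
  | zero => norm_num [q]
  | succ k ih =>
    have hk : (0 : ℝ) ≤ k := k.cast_nonneg
    have hx : 4 / ((k : ℝ) + 4) ≤ 2 := by
      rw [div_le_iff₀ (by linarith)]
      linarith
    simp only [q]
    push_cast
    calc 1 - 4 / ((k : ℝ) + 1 + 4) ≤ (1 - 4 / ((k : ℝ) + 4) / 2) ^ 2 := by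
          rw [← sub_nonneg]
          have h : (1 - 4 / ((k : ℝ) + 4) / 2) ^ 2 - (1 - 4 / ((k : ℝ) + 1 + 4))
              = 4 / ((k + 4) ^ 2 * (k + 1 + 4)) := by
            field_simp
            ring
          rw [h]
          positivity
      _ ≤ Real.exp (-(4 / ((k : ℝ) + 4))) := one_sub_half_sq_le_exp_neg hx
      _ ≤ Real.exp (-(1 - q k)) := Real.exp_le_exp.mpr (by linarith)

/-- `0 ≤ q k ≤ 1` for all `k`, and `q k = 1 − O(1/k)`, i.e.
there is a constant `C > 0` with `q k ≥ 1 − C/k` for all `k ≥ 1`. -/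
theorem q_bounds :
    (∀ k : ℕ, 0 ≤ q k ∧ q k ≤ 1) ∧
      ∃ C : ℝ, 0 < C ∧ ∀ k : ℕ, 1 ≤ k → 1 - C / k ≤ q k := by
  refine ⟨q_mem_Icc, 4, by norm_num, fun k hk => ?_⟩
  have hk' : (0 : ℝ) < k := by exact_mod_cast hk
  have h : 4 / ((k : ℝ) + 4) ≤ 4 / k := by
    gcongr
    linarith
  linarith [one_sub_four_div_add_four_le_q k]
end

section
/- Let V be a finite set of size n, let (p_v)_{v∈V} be a probability vector, let k ≥ 0 and 1 ≤ ℓ ≤ n be integers. Let f : V → V be a random function whose values f(v) are independent, each distributed according to (p_v), and independently let S ⊆ V be a uniformly random subset of size ℓ. Then the probability that no vertex v ∈ V satisfies d(v→S) = k is at least q_k^ℓ, where d(v→S) := min{m ≥ 0 : f^[m](v) ∈ S} (with d(v→S) = ∞ if f^[m](v) ∉ S for all m ≥ 0), and (q_k) is defined by q₀ = 0, q_{k+1} = exp(−(1−q_k)). -/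
open scoped BigOperators Classical

theorem q_mem_Icc_s9 (k : ℕ) : q k ∈ Set.Icc (0 : ℝ) 1 := by
  induction k with
  | zero => simp [q]
  | succ k ih =>
    refine ⟨(Real.exp_pos _).le, ?_⟩
    rw [q, Real.exp_le_one_iff]
    linarith [ih.2]

theorem exp_neg_mul_le_pow {a : ℝ} (ha0 : 0 ≤ a) (ha1 : a ≤ 1) {N ℓ : ℕ} (hℓ : ℓ ≤ N) :
    Real.exp (-a) ^ ℓ ≤ (1 - a * (ℓ / N)) ^ (N - ℓ) := by
  obtain ⟨m, rfl⟩ := Nat.exists_eq_add_of_le hℓ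
  rw [Nat.add_sub_cancel_left, ← Real.exp_nat_mul]
  rcases m.eq_zero_or_pos with rfl | hm
  · simpa using mul_nonneg (Nat.cast_nonneg ℓ) ha0
  have hm' : (0 : ℝ) < m := by exact_mod_cast hm
  have hℓ' : (0 : ℝ) ≤ ℓ := by positivity
  push_cast
  set y : ℝ := 1 - a * (ℓ / (ℓ + m)) with hy
  have hN : (0 : ℝ) < ℓ + m := by positivity
  have hNy : (ℓ + m) * (y - 1) = -(a * ℓ) := by rw [hy]; field_simp; ring
  have hmy : (m : ℝ) ≤ (ℓ + m) * y := by nlinarith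
  have hy0 : 0 < y := by
    by_contra! h
    nlinarith
  have hy1 : y ≤ 1 := by
    by_contra! h
    nlinarith [mul_nonneg ha0 hℓ']
  rw [← Real.exp_log (pow_pos hy0 m), Real.exp_le_exp, Real.log_pow]
  calc (ℓ : ℝ) * -a = ((ℓ + m) * y) * (1 - y⁻¹) := by
        have : y * (1 - y⁻¹) = y - 1 := by field_simp
        rw [mul_assoc, this, hNy]; ring
    _ ≤ m * (1 - y⁻¹) := by
        refine mul_le_mul_of_nonpos_right hmy ?_
        have := (one_le_inv₀ hy0).2 hy1
        linarith
    _ ≤ m * Real.log y :=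
        mul_le_mul_of_nonneg_left (Real.one_sub_inv_le_log_of_pos hy0) hm'.le

section Averaging

variable {α : Type*} [DecidableEq α]

theorem sum_powersetCard_sum (p : α → ℝ) (U : Finset α) {ℓ : ℕ} (hℓ : ℓ ≤ U.card) :
    ∑ S ∈ U.powersetCard ℓ, ∑ v ∈ S, p v
      = U.card.choose ℓ * ((ℓ / U.card) * ∑ v ∈ U, p v) := by
  rcases ℓ with _ | ℓ
  · simp
  have hswap : ∑ S ∈ U.powersetCard (ℓ + 1), ∑ v ∈ S, p v
      = ∑ v ∈ U, ∑ S ∈ (U.powersetCard (ℓ + 1)).filter ({v} ⊆ ·), p v := by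
    refine Finset.sum_comm' fun S v => ?_
    simp only [Finset.mem_powersetCard, Finset.mem_filter, Finset.singleton_subset_iff]
    exact ⟨fun h => ⟨⟨h.1, h.2⟩, h.1.1 h.2⟩, fun h => h.1⟩
  have hcard : ∀ v ∈ U, ∑ S ∈ (U.powersetCard (ℓ + 1)).filter ({v} ⊆ ·), p v
      = (U.card - 1).choose ℓ * p v := fun v hv => by
    rw [Finset.sum_const, nsmul_eq_mul, Finset.card_filter_powersetCard_subset]
    · simp
    all_goals simp [hv]
  rw [hswap, Finset.sum_congr rfl hcard, ← Finset.mul_sum, ← mul_assoc]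
  congr 1
  obtain ⟨N, hN⟩ : ∃ N, U.card = N + 1 := ⟨U.card - 1, by omega⟩
  rw [hN, Nat.add_sub_cancel]
  have := Nat.add_one_mul_choose_eq N ℓ
  have h : ((N : ℝ) + 1) * N.choose ℓ = (N + 1).choose (ℓ + 1) * (ℓ + 1) := by exact_mod_cast this
  push_cast
  field_simp
  linarith

theorem choose_mul_pow_le_sum_powersetCard (p : α → ℝ) (hp : ∀ v, 0 ≤ p v) (U : Finset α) {ℓ : ℕ}
    (hℓ : ℓ ≤ U.card) {a : ℝ} (ha1 : a ≤ 1) (m : ℕ) :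
    U.card.choose ℓ * ((1 - a * (ℓ / U.card)) * ∑ v ∈ U, p v) ^ m
      ≤ ∑ S ∈ U.powersetCard ℓ, (∑ v ∈ U, p v - a * ∑ v ∈ S, p v) ^ m := by
  set P := ∑ v ∈ U, p v
  have hC : (0 : ℝ) < U.card.choose ℓ := by exact_mod_cast Nat.choose_pos hℓ
  have hJ := Real.pow_arith_mean_le_arith_mean_pow (U.powersetCard ℓ)
    (fun _ => ((U.card.choose ℓ : ℝ))⁻¹) (fun S => P - a * ∑ v ∈ S, p v)
    (fun _ _ => by positivity)
    (by rw [Finset.sum_const, Finset.card_powersetCard, nsmul_eq_mul, mul_inv_cancel₀ hC.ne'])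
    (fun S hS => by
      have hSU : ∑ v ∈ S, p v ≤ P := Finset.sum_le_sum_of_subset_of_nonneg
        (Finset.mem_powersetCard.1 hS).1 fun v _ _ => hp v
      have hS0 : 0 ≤ ∑ v ∈ S, p v := Finset.sum_nonneg fun v _ => hp v
      nlinarith) m
  rw [← Finset.mul_sum, ← Finset.mul_sum, Finset.sum_sub_distrib, ← Finset.mul_sum,
    sum_powersetCard_sum p U hℓ, Finset.sum_const, Finset.card_powersetCard, nsmul_eq_mul] at hJ
  have hmean : (U.card.choose ℓ : ℝ)⁻¹ * (U.card.choose ℓ * P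
      - a * (U.card.choose ℓ * ((ℓ / U.card) * P))) = (1 - a * (ℓ / U.card)) * P := by
    field_simp
  rw [hmean] at hJ
  rwa [inv_mul_eq_div, le_div_iff₀' hC] at hJ

end Averaging

section Recursion

variable {α : Type*} [DecidableEq α]

/-- The probability that every `v ∈ U \ S` is mapped into `U` and that no vertex of `U` is at
distance `k` from `S`, computed by exposing the vertices at distance one from `S`. -/
noncomputable def avoidProb (p : α → ℝ) : ℕ → Finset α → Finset α → ℝ
  | 0, U, S => if S = ∅ then (∑ v ∈ U, p v) ^ U.card else 0
  | k + 1, U, S => ∑ T ∈ (U \ S).powerset, (∑ v ∈ S, p v) ^ T.card * avoidProb p k (U \ S) T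

theorem le_sum_avoidProb (p : α → ℝ) (hp : ∀ v, 0 ≤ p v) (k : ℕ) (U : Finset α) {ℓ : ℕ}
    (hℓ : ℓ ≤ U.card) :
    U.card.choose ℓ * (q k ^ ℓ * (∑ v ∈ U, p v) ^ (U.card - ℓ))
      ≤ ∑ S ∈ U.powersetCard ℓ, avoidProb p k U S := by
  induction k generalizing U ℓ with
  | zero =>
    rcases ℓ with _ | ℓ
    · simp [avoidProb]
    · rw [q, zero_pow ℓ.succ_ne_zero, zero_mul, mul_zero]
      refine Finset.sum_nonneg fun S _ => ?_
      rw [avoidProb]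
      split_ifs
      · exact pow_nonneg (Finset.sum_nonneg fun v _ => hp v) _
      · exact le_rfl
  | succ k ih =>
    obtain ⟨hq0, hq1⟩ := q_mem_Icc_s9 k
    have hP : 0 ≤ ∑ v ∈ U, p v := Finset.sum_nonneg fun v _ => hp v
    calc (U.card.choose ℓ : ℝ) * (q (k + 1) ^ ℓ * (∑ v ∈ U, p v) ^ (U.card - ℓ))
        ≤ U.card.choose ℓ * ((1 - (1 - q k) * (ℓ / U.card)) * ∑ v ∈ U, p v) ^ (U.card - ℓ) := by
          rw [mul_pow, q]
          gcongr
          exact exp_neg_mul_le_pow (by linarith) (by linarith) hℓ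
      _ ≤ ∑ S ∈ U.powersetCard ℓ, (∑ v ∈ U, p v - (1 - q k) * ∑ v ∈ S, p v) ^ (U.card - ℓ) :=
          choose_mul_pow_le_sum_powersetCard p hp U hℓ (by linarith) _
      _ ≤ ∑ S ∈ U.powersetCard ℓ, avoidProb p (k + 1) U S := by
          refine Finset.sum_le_sum fun S hS => ?_
          obtain ⟨hSU, hSc⟩ := Finset.mem_powersetCard.1 hS
          have hcard : (U \ S).card = U.card - ℓ := by rw [Finset.card_sdiff_of_subset hSU, hSc]
          have hsplit : ∑ v ∈ U, p v - (1 - q k) * ∑ v ∈ S, p v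
              = q k * ∑ v ∈ S, p v + ∑ v ∈ U \ S, p v := by
            rw [← Finset.sum_sdiff hSU]; ring
          rw [avoidProb, Finset.sum_powerset, hsplit, ← hcard, add_pow]
          refine Finset.sum_le_sum fun t ht => ?_
          have hsum : ∑ T ∈ (U \ S).powersetCard t,
              (∑ v ∈ S, p v) ^ T.card * avoidProb p k (U \ S) T
              = (∑ v ∈ S, p v) ^ t * ∑ T ∈ (U \ S).powersetCard t, avoidProb p k (U \ S) T := by
            rw [Finset.mul_sum]
            exact Finset.sum_congr rfl fun T hT => by rw [(Finset.mem_powersetCard.1 hT).2]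
          rw [hsum]
          calc _ = (∑ v ∈ S, p v) ^ t * ((U \ S).card.choose t *
                (q k ^ t * (∑ v ∈ U \ S, p v) ^ ((U \ S).card - t))) := by ring
            _ ≤ _ := mul_le_mul_of_nonneg_left
                (ih (U \ S) (Nat.lt_succ_iff.1 (Finset.mem_range.1 ht)))
                (pow_nonneg (Finset.sum_nonneg fun v _ => hp v) _)

end Recursion

section RandomFunction

variable {α : Type*} [DecidableEq α]

/-- Every `v ∈ U \ S` is mapped into `U`, and no vertex of `U` is at distance `k` from `S`. -/
def Avoids (k : ℕ) (U S : Finset α) (f : α → α) : Prop :=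
  (∀ v ∈ U \ S, f v ∈ U) ∧ ¬ ∃ v ∈ U, f^[k] v ∈ S ∧ ∀ m < k, f^[m] v ∉ S

theorem avoids_zero_iff {U S : Finset α} (hSU : S ⊆ U) (f : α → α) :
    Avoids 0 U S f ↔ S = ∅ ∧ ∀ v ∈ U, f v ∈ U := by
  constructor
  · rintro ⟨h, h'⟩
    obtain rfl : S = ∅ := by
      by_contra hS
      obtain ⟨v, hv⟩ := Finset.nonempty_iff_ne_empty.2 hS
      exact h' ⟨v, hSU hv, hv, by simp⟩
    simpa using h
  · rintro ⟨rfl, h⟩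
    exact ⟨by simpa using h, by simp⟩

theorem avoids_succ_iff (k : ℕ) {U S : Finset α} (hSU : S ⊆ U) (f : α → α) :
    Avoids (k + 1) U S f ↔ Avoids k (U \ S) ((U \ S).filter (f · ∈ S)) f := by
  constructor
  · rintro ⟨h, h'⟩
    have hstep : ∀ v ∈ (U \ S) \ (U \ S).filter (f · ∈ S), f v ∈ U \ S := by
      intro v hv
      simp only [Finset.mem_sdiff, Finset.mem_filter] at hv ⊢
      exact ⟨h v (Finset.mem_sdiff.2 hv.1), fun hf => hv.2 ⟨hv.1, hf⟩⟩
    refine ⟨hstep, ?_⟩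
    rintro ⟨v, hv, hk, hlt⟩
    have hpath : ∀ m ≤ k, f^[m] v ∈ U \ S := by
      intro m hm
      induction m with
      | zero => exact hv
      | succ m ih =>
        rw [Function.iterate_succ_apply']
        exact hstep _ (Finset.mem_sdiff.2 ⟨ih (by omega), hlt m (by omega)⟩)
    refine h' ⟨v, (Finset.mem_sdiff.1 hv).1, ?_, fun m hm => ?_⟩
    · rw [Function.iterate_succ_apply']
      exact (Finset.mem_filter.1 hk).2
    · exact (Finset.mem_sdiff.1 (hpath m (by omega))).2
  · rintro ⟨h, h'⟩
    have hstep : ∀ v ∈ U \ S, f v ∈ U := by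
      intro v hv
      by_cases hf : f v ∈ S
      · exact hSU hf
      · have := h v (Finset.mem_sdiff.2 ⟨hv, fun hv' => hf (Finset.mem_filter.1 hv').2⟩)
        exact (Finset.mem_sdiff.1 this).1
    refine ⟨hstep, ?_⟩
    rintro ⟨v, hv, hk, hlt⟩
    have hpath : ∀ m ≤ k, f^[m] v ∈ U \ S := by
      intro m hm
      induction m with
      | zero => exact Finset.mem_sdiff.2 ⟨hv, hlt 0 (by omega)⟩
      | succ m ih =>
        refine Finset.mem_sdiff.2 ⟨?_, hlt (m + 1) (by omega)⟩
        rw [Function.iterate_succ_apply']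
        exact hstep _ (ih (by omega))
    refine h' ⟨v, hpath 0 (by omega), Finset.mem_filter.2 ⟨hpath k le_rfl, ?_⟩, fun m hm hmem => ?_⟩
    · rwa [Function.iterate_succ_apply'] at hk
    · have := (Finset.mem_filter.1 hmem).2
      exact hlt (m + 1) (by omega) (by rwa [Function.iterate_succ_apply'])

theorem indicator_avoids_succ (k : ℕ) {U S : Finset α} (hSU : S ⊆ U) (f : α → α) :
    (if Avoids (k + 1) U S f then (1 : ℝ) else 0)
      = ∑ T ∈ (U \ S).powerset,
          (if ∀ v ∈ T, f v ∈ S then 1 else 0) * (if Avoids k (U \ S) T f then 1 else 0) := by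
  rw [Finset.sum_eq_single ((U \ S).filter (f · ∈ S))]
  · have : ∀ v ∈ (U \ S).filter (f · ∈ S), f v ∈ S := fun v hv => (Finset.mem_filter.1 hv).2
    rw [if_pos this, one_mul]
    simp only [avoids_succ_iff k hSU f]
  · intro T hT hne
    by_cases h1 : ∀ v ∈ T, f v ∈ S
    · rw [if_neg (c := Avoids k (U \ S) T f), mul_zero]
      rintro ⟨h2, -⟩
      refine hne (Finset.Subset.antisymm (fun v hv => Finset.mem_filter.2
        ⟨Finset.mem_powerset.1 hT hv, h1 v hv⟩) fun v hv => ?_)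
      obtain ⟨hvU, hvS⟩ := Finset.mem_filter.1 hv
      by_contra hvT
      exact (Finset.mem_sdiff.1 (h2 v (Finset.mem_sdiff.2 ⟨hvU, hvT⟩))).2 hvS
    · rw [if_neg h1, zero_mul]
  · intro h
    exact absurd (Finset.mem_powerset.2 (Finset.filter_subset _ _)) h

variable [Fintype α]

theorem prod_mul_indicator (w : α → α → ℝ) (T S : Finset α) (f : α → α)
    [Decidable (∀ v ∈ T, f v ∈ S)] :
    (∏ v, w v (f v)) * (if ∀ v ∈ T, f v ∈ S then (1 : ℝ) else 0)
      = ∏ v, w v (f v) * (if v ∈ T → f v ∈ S then 1 else 0) := by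
  rw [Finset.prod_mul_distrib, Finset.prod_boole]
  simp

theorem sum_prod_apply (w : α → α → ℝ) : ∑ f : α → α, ∏ v, w v (f v) = ∏ v, ∑ x, w v x := by
  rw [Finset.prod_univ_sum, Fintype.piFinset_univ]

theorem sum_indicator_avoids (p : α → ℝ) (k : ℕ) {U S : Finset α} (hSU : S ⊆ U)
    (w : α → α → ℝ) (hw : ∀ v ∈ U \ S, w v = p) :
    ∑ f : α → α, (∏ v, w v (f v)) * (if Avoids k U S f then 1 else 0)
      = avoidProb p k U S * ∏ v ∈ (U \ S)ᶜ, ∑ x, w v x := by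
  induction k generalizing U S w with
  | zero =>
    simp only [avoids_zero_iff hSU, avoidProb]
    by_cases hS : S = ∅
    · subst hS
      simp only [true_and, if_true, prod_mul_indicator, Finset.sdiff_empty] at hw ⊢
      rw [sum_prod_apply fun v x => w v x * (if v ∈ U → x ∈ U then 1 else 0),
        ← Finset.prod_mul_prod_compl U]
      congr 1
      · rw [← Finset.prod_const]
        refine Finset.prod_congr rfl fun v hv => ?_
        simp [hw v hv, hv]
      · refine Finset.prod_congr rfl fun v hv => ?_
        simp [Finset.mem_compl.1 hv]
    · simp [hS]
  | succ k ih =>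
    simp only [indicator_avoids_succ k hSU, Finset.mul_sum, avoidProb, Finset.sum_mul]
    rw [Finset.sum_comm]
    refine Finset.sum_congr rfl fun T hT => ?_
    have hTU := Finset.mem_powerset.1 hT
    simp only [← mul_assoc, prod_mul_indicator]
    rw [ih hTU (fun v x => w v x * (if v ∈ T → x ∈ S then 1 else 0)) fun v hv => by
      obtain ⟨hv, hvT⟩ := Finset.mem_sdiff.1 hv
      funext x
      simp [hw v hv, hvT]]
    have hcompl : ((U \ S) \ T)ᶜ = T ∪ (U \ S)ᶜ := by
      ext v
      have := @hTU v
      simp only [Finset.mem_compl, Finset.mem_sdiff, Finset.mem_union] at this ⊢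
      tauto
    rw [hcompl, Finset.prod_union (Finset.disjoint_left.2 fun v hv hv' =>
      Finset.mem_compl.1 hv' (hTU hv)), mul_comm ((∑ v ∈ S, p v) ^ T.card), mul_assoc]
    congr 2
    · rw [← Finset.prod_const]
      refine Finset.prod_congr rfl fun v hv => ?_
      simp [hw v (hTU hv), hv]
    · refine Finset.prod_congr rfl fun v hv => ?_
      have : v ∉ T := fun hvT => Finset.mem_compl.1 hv (hTU hvT)
      simp [this]

end RandomFunction

/-- Let `f : Fin n → Fin n` be a random function with independent
values distributed according to a probability vector `(p_v)`, and let `S` be an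
independent uniformly random subset of size `ℓ` (with `1 ≤ ℓ ≤ n`). The
probability that no vertex `v` satisfies `d(v→S) = k` (i.e. `f^[k](v) ∈ S` and
`f^[m](v) ∉ S` for all `m < k`) is at least `q_k ^ ℓ`. -/
theorem no_vertex_at_distance_k_prob
    (n : ℕ) (p : Fin n → ℝ) (hp : ∀ v, 0 ≤ p v) (hsum : (∑ v, p v) = 1)
    (k ℓ : ℕ) (hℓ1 : 1 ≤ ℓ) (hℓn : ℓ ≤ n) :
    q k ^ ℓ ≤
      (∑ S ∈ Finset.univ.powersetCard ℓ,
          ∑ f : Fin n → Fin n, (∏ v, p (f v)) *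
            (if ¬ ∃ v : Fin n, f^[k] v ∈ S ∧ ∀ m < k, f^[m] v ∉ S
              then (1 : ℝ) else 0))
        / (n.choose ℓ : ℝ) := by
  have hC : (0 : ℝ) < n.choose ℓ := by exact_mod_cast Nat.choose_pos hℓn
  have hmain := le_sum_avoidProb p hp k Finset.univ (ℓ := ℓ) (by simpa using hℓn)
  rw [le_div_iff₀' hC]
  simp only [Finset.card_univ, Fintype.card_fin, hsum, one_pow, mul_one] at hmain
  refine hmain.trans (Finset.sum_le_sum fun S _ => le_of_eq ?_)
  have h := sum_indicator_avoids p k (Finset.subset_univ S) (fun _ => p) fun _ _ => rfl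
  simp only [hsum, Finset.prod_const_one, mul_one] at h
  rw [← h]
  refine Finset.sum_congr rfl fun f _ => ?_
  congr 1
  simp [Avoids]
end

section
/- For any real number x with 0 < x ≤ 1 and any integers a, b with 0 ≤ a ≤ b and b ≥ 1, we have (1 − (a/b)·x)^(b−a) ≥ exp(−a·x). -/
/-- For `0 < x ≤ 1` and integers `0 ≤ a ≤ b` with `b ≥ 1`,
`(1 − (a/b)·x)^(b−a) ≥ exp(−a·x)`. -/
theorem one_sub_div_pow_ge_exp
    (x : ℝ) (hx0 : 0 < x) (hx1 : x ≤ 1) (a b : ℕ) (hab : a ≤ b) (hb : 1 ≤ b) :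
    Real.exp (-(a * x)) ≤ (1 - ((a : ℝ) / b) * x) ^ (b - a) := by
  have ha : (0 : ℝ) ≤ a := a.cast_nonneg
  have hax : (a : ℝ) * x ≤ a := mul_le_of_le_one_right ha hx1
  have hax0 : 0 ≤ (a : ℝ) * x := by positivity
  rcases hab.eq_or_lt with rfl | hlt
  · simpa using hax0
  have hlt' : (a : ℝ) < b := by exact_mod_cast hlt
  have hb0 : (0 : ℝ) < b := by exact_mod_cast hb
  have hd : 0 < (b : ℝ) - a * x := by linarith
  have hu : 1 - (a : ℝ) / b * x = (b - a * x) / b := by field_simp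
  have hpos : 0 < 1 - (a : ℝ) / b * x := hu ▸ div_pos hd hb0
  rw [← Real.le_log_iff_exp_le (pow_pos hpos _), Real.log_pow, Nat.cast_sub hab]
  refine le_trans ?_ (mul_le_mul_of_nonneg_left (Real.one_sub_inv_le_log_of_pos hpos)
    (sub_nonneg.2 hlt'.le))
  have hinv : 1 - (1 - (a : ℝ) / b * x)⁻¹ = -(a * x) / (b - a * x) := by
    rw [hu, inv_div, eq_div_iff hd.ne', sub_mul, div_mul_cancel₀ _ hd.ne']
    ring
  rw [hinv, mul_div_assoc', le_div_iff₀ hd]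
  nlinarith [mul_nonneg hax0 (sub_nonneg.2 hax)]
end

section
/- Let δ : Fin n × {a,b} → Fin n be a uniformly random transition function, and for states x, y let d(x,y) denote the length of the shortest word ω ∈ {a,b}* with δ_ω(x) = δ_ω(y) (d(x,y) = ∞ if no such word exists). Then max over pairs of distinct states x ≠ y of Pr(d(x,y) > 2·log₂ n) tends to 0 as n → ∞; equivalently, for every pair of distinct states x, y, Pr(d(x,y) ≤ 2·log₂ n) = 1 − o(1) uniformly in the pair. -/
open scoped BigOperators Classical

/-- `run δ ω x` applies the transitions of the word `ω` (over the two-letter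
alphabet `Bool`, with `false = 'a'` and `true = 'b'`) starting from state `x`,
i.e. `run δ ω = δ_ω = δ_{ω_k} ∘ ⋯ ∘ δ_{ω_1}`. -/
def run {n : ℕ} (δ : Fin n × Bool → Fin n) : List Bool → Fin n → Fin n
  | [], x => x
  | c :: w, x => run δ w (δ (x, c))

/-- The mean of `F` over the uniformly random functions that agree with `σ` on `D`. -/
noncomputable def condMean {α β : Type*} [Fintype α] [DecidableEq α] [Fintype β]
    (D : Finset α) (σ : α → β) (F : (α → β) → ℝ) : ℝ :=
  (∑ τ : α → β, F (D.piecewise σ τ)) / Fintype.card (α → β)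

section CondMean

variable {α β : Type*} [Fintype α] [DecidableEq α] [Fintype β]

lemma condMean_empty (σ : α → β) (F : (α → β) → ℝ) :
    condMean ∅ σ F = (∑ τ : α → β, F τ) / Fintype.card (α → β) := by
  simp [condMean]

lemma condMean_mono {D : Finset α} {σ : α → β} {F F' : (α → β) → ℝ}
    (h : ∀ δ, (∀ e ∈ D, δ e = σ e) → F δ ≤ F' δ) : condMean D σ F ≤ condMean D σ F' := by
  unfold condMean
  gcongr with τ
  exact h _ fun e he => by simp [he]

lemma condMean_congr {D : Finset α} {σ : α → β} {F F' : (α → β) → ℝ}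
    (h : ∀ δ, (∀ e ∈ D, δ e = σ e) → F δ = F' δ) : condMean D σ F = condMean D σ F' :=
  le_antisymm (condMean_mono fun δ hδ => (h δ hδ).le) (condMean_mono fun δ hδ => (h δ hδ).ge)

lemma condMean_const (D : Finset α) (σ : α → β) (c : ℝ) :
    condMean D σ (fun _ => c) = c := by
  have : Nonempty (α → β) := ⟨σ⟩
  simp [condMean, -Fintype.card_pi]

lemma condMean_sub (D : Finset α) (σ : α → β) (F F' : (α → β) → ℝ) :
    condMean D σ (fun δ => F δ - F' δ) = condMean D σ F - condMean D σ F' := by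
  simp only [condMean, Finset.sum_sub_distrib, sub_div]

lemma condMean_add (D : Finset α) (σ : α → β) (F F' : (α → β) → ℝ) :
    condMean D σ (fun δ => F δ + F' δ) = condMean D σ F + condMean D σ F' := by
  simp only [condMean, Finset.sum_add_distrib, add_div]

lemma condMean_const_mul (D : Finset α) (σ : α → β) (c : ℝ) (F : (α → β) → ℝ) :
    condMean D σ (fun δ => c * F δ) = c * condMean D σ F := by
  simp only [condMean, ← Finset.mul_sum, mul_div_assoc]

lemma condMean_sum {ι : Type*} (s : Finset ι) (D : Finset α) (σ : α → β)
    (F : ι → (α → β) → ℝ) :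
    condMean D σ (fun δ => ∑ i ∈ s, F i δ) = ∑ i ∈ s, condMean D σ (F i) := by
  simp only [condMean, ← Finset.sum_div]
  rw [Finset.sum_comm]

lemma condMean_le_of_le {D : Finset α} {σ : α → β} {F : (α → β) → ℝ} {c : ℝ}
    (h : ∀ δ, F δ ≤ c) : condMean D σ F ≤ c :=
  (condMean_mono fun δ _ => h δ).trans_eq (condMean_const D σ c)

lemma le_condMean_of_le {D : Finset α} {σ : α → β} {F : (α → β) → ℝ} {c : ℝ}
    (h : ∀ δ, c ≤ F δ) : c ≤ condMean D σ F :=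
  (condMean_const D σ c).symm.trans_le (condMean_mono fun δ _ => h δ)

/-- A coordinate of a uniformly random function is independent of anything that does not
depend on that coordinate. -/
lemma card_mul_sum_eval (e : α) (H : β → (α → β) → ℝ)
    (hH : ∀ v τ w, H v (Function.update τ e w) = H v τ) :
    Fintype.card β * ∑ τ : α → β, H (τ e) τ = ∑ v, ∑ τ : α → β, H v τ := by
  have key : ∑ q : (α → β) × β, H (q.1 e) q.1 = ∑ q : (α → β) × β, H q.2 q.1 := by
    have hinv : Function.Involutive
        (fun q : (α → β) × β => (Function.update q.1 e q.2, q.1 e)) := by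
      intro q
      simp
    refine Fintype.sum_equiv hinv.toPerm _ _ fun q => ?_
    simp [hH]
  rw [Fintype.sum_prod_type, Fintype.sum_prod_type_right] at key
  simpa [Finset.mul_sum] using key

/-- Exposing the value of a uniformly random function at a fresh point. -/
lemma condMean_expose {D : Finset α} {e : α} (he : e ∉ D) (σ : α → β)
    (H : β → (α → β) → ℝ) :
    condMean D σ (fun δ => H (δ e) δ) =
      (∑ v, condMean (insert e D) (Function.update σ e v) (H v)) / Fintype.card β := by
  have : Nonempty β := ⟨σ e⟩
  have hβ : (Fintype.card β : ℝ) ≠ 0 := by simp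
  have h := card_mul_sum_eval e
    (fun v τ => H v ((insert e D).piecewise (Function.update σ e v) τ)) (by
      intro v τ w
      congr 1
      ext i
      by_cases hi : i ∈ insert e D
      · simp [Finset.piecewise, hi]
      · have : i ≠ e := fun h => hi (by simp [h])
        simp [Finset.piecewise, hi, this])
  have h2 : ∀ τ : α → β, (insert e D).piecewise (Function.update σ e (τ e)) τ =
      D.piecewise σ τ := by
    intro τ
    ext i
    by_cases hi : i = e
    · subst hi
      simp [he]
    · by_cases hD : i ∈ D <;> simp [Finset.piecewise, hi, hD]
  simp only [h2] at h
  simp only [condMean, ← Finset.sum_div]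
  rw [← h, div_right_comm, mul_div_cancel_left₀ _ hβ]
  simp [he]

lemma condMean_expose_le {D : Finset α} {e : α} (he : e ∉ D) {σ : α → β}
    {H : β → (α → β) → ℝ} {b : β → ℝ}
    (h : ∀ v σ', condMean (insert e D) σ' (H v) ≤ b v) :
    condMean D σ (fun δ => H (δ e) δ) ≤ (∑ v, b v) / Fintype.card β := by
  rw [condMean_expose he]
  gcongr
  exact h _ _

lemma condMean_expose_pair_le {D : Finset α} {e₁ e₂ : α} (h₁ : e₁ ∉ D) (h₂ : e₂ ∉ D)
    (hne : e₁ ≠ e₂) {σ : α → β} {H : β → β → (α → β) → ℝ} {b : β → β → ℝ}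
    (h : ∀ v₁ v₂ σ', condMean (insert e₂ (insert e₁ D)) σ' (H v₁ v₂) ≤ b v₁ v₂) :
    condMean D σ (fun δ => H (δ e₁) (δ e₂) δ) ≤
      (∑ v₁, ∑ v₂, b v₁ v₂) / (Fintype.card β : ℝ) ^ 2 := by
  have h₂' : e₂ ∉ insert e₁ D := by simp [h₂, hne.symm]
  refine (condMean_expose_le h₁ (H := fun v δ => H v (δ e₂) δ) fun v σ' =>
    condMean_expose_le h₂' (H := H v) (h v)).trans_eq ?_
  rw [← Finset.sum_div, div_div, sq]

lemma le_condMean_expose_pair {D : Finset α} {e₁ e₂ : α} (h₁ : e₁ ∉ D) (h₂ : e₂ ∉ D)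
    (hne : e₁ ≠ e₂) {σ : α → β} {H : β → β → (α → β) → ℝ} {b : β → β → ℝ}
    (h : ∀ v₁ v₂ σ', b v₁ v₂ ≤ condMean (insert e₂ (insert e₁ D)) σ' (H v₁ v₂)) :
    (∑ v₁, ∑ v₂, b v₁ v₂) / (Fintype.card β : ℝ) ^ 2 ≤
      condMean D σ (fun δ => H (δ e₁) (δ e₂) δ) := by
  have hneg := condMean_expose_pair_le h₁ h₂ hne (σ := σ) (H := fun v₁ v₂ δ => -1 * H v₁ v₂ δ)
    (b := fun v₁ v₂ => -b v₁ v₂) (fun v₁ v₂ σ' => by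
      rw [condMean_const_mul]
      linarith [h v₁ v₂ σ'])
  rw [condMean_const_mul] at hneg
  simp only [Finset.sum_neg_distrib, neg_div] at hneg
  linarith

end CondMean

section Merging

variable {n : ℕ}

/-- The indicator that the word takes `p` and `q` to the same state while no proper prefix
of it does. -/
noncomputable def firstMerge : List Bool → Fin n → Fin n → (Fin n × Bool → Fin n) → ℝ
  | [], p, q, _ => if p = q then 1 else 0
  | c :: w, p, q, δ => if p = q then 0 else firstMerge w (δ (p, c)) (δ (q, c)) δ

/-- The indicator that the word takes `p` and `q` to the same state, and that before the last
letter the two walks avoid `U`, each other, and their own past. -/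
noncomputable def simpleMerge :
    Finset (Fin n) → List Bool → Fin n → Fin n → (Fin n × Bool → Fin n) → ℝ
  | _, [], p, q, _ => if p = q then 1 else 0
  | U, c :: w, p, q, δ =>
    if p ≠ q ∧ p ∉ U ∧ q ∉ U then
      simpleMerge (insert p (insert q U)) w (δ (p, c)) (δ (q, c)) δ
    else 0

lemma firstMerge_nonneg (w : List Bool) (p q : Fin n) (δ : Fin n × Bool → Fin n) :
    0 ≤ firstMerge w p q δ := by
  induction w generalizing p q with
  | nil => simp only [firstMerge]; split_ifs <;> norm_num
  | cons c w ih => simp only [firstMerge]; split_ifs <;> simp [ih]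

lemma firstMerge_le_one (w : List Bool) (p q : Fin n) (δ : Fin n × Bool → Fin n) :
    firstMerge w p q δ ≤ 1 := by
  induction w generalizing p q with
  | nil => simp only [firstMerge]; split_ifs <;> norm_num
  | cons c w ih => simp only [firstMerge]; split_ifs <;> simp [ih]

lemma firstMerge_comm (w : List Bool) (p q : Fin n) (δ : Fin n × Bool → Fin n) :
    firstMerge w p q δ = firstMerge w q p δ := by
  induction w generalizing p q with
  | nil => simp only [firstMerge, eq_comm]
  | cons c w ih => simp only [firstMerge, eq_comm (a := p), ih (δ (p, c))]

lemma simpleMerge_nonneg (U : Finset (Fin n)) (w : List Bool) (p q : Fin n)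
    (δ : Fin n × Bool → Fin n) : 0 ≤ simpleMerge U w p q δ := by
  induction w generalizing U p q with
  | nil => simp only [simpleMerge]; split_ifs <;> norm_num
  | cons c w ih => simp only [simpleMerge]; split_ifs <;> simp [ih]

lemma simpleMerge_mul_self (U : Finset (Fin n)) (w : List Bool) (p q : Fin n)
    (δ : Fin n × Bool → Fin n) :
    simpleMerge U w p q δ * simpleMerge U w p q δ = simpleMerge U w p q δ := by
  induction w generalizing U p q with
  | nil => simp only [simpleMerge]; split_ifs <;> norm_num
  | cons c w ih => simp only [simpleMerge]; split_ifs <;> simp [ih]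

lemma simpleMerge_le_firstMerge (U : Finset (Fin n)) (w : List Bool) (p q : Fin n)
    (δ : Fin n × Bool → Fin n) : simpleMerge U w p q δ ≤ firstMerge w p q δ := by
  induction w generalizing U p q with
  | nil => exact le_rfl
  | cons c w ih =>
    simp only [simpleMerge, firstMerge]
    split_ifs <;> first | simp [ih] | simp [firstMerge_nonneg] | tauto

lemma simpleMerge_eq_zero_of_run_ne {U : Finset (Fin n)} {w : List Bool} {p q : Fin n}
    {δ : Fin n × Bool → Fin n} (h : run δ w p ≠ run δ w q) : simpleMerge U w p q δ = 0 := by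
  induction w generalizing U p q with
  | nil => simpa [simpleMerge, run] using h
  | cons c w ih =>
    simp only [simpleMerge]
    split_ifs
    · exact ih h
    · rfl

lemma sum_mem_indicator (S : Finset (Fin n)) :
    ∑ v, (if v ∈ S then (1 : ℝ) else 0) = S.card := by
  simp

/-- If `q` has no exposed transition and `p ≠ q`, then merging costs a factor of order `1 / n`. -/
lemma condMean_firstMerge_le_of_fresh (hn : 0 < n) {K : ℕ} (w : List Bool) :
    ∀ (D : Finset (Fin n × Bool)) (σ : Fin n × Bool → Fin n) (p q : Fin n), p ≠ q →
      q ∉ D.image Prod.fst → D.card + 2 * w.length ≤ K →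
      condMean D σ (firstMerge w p q) ≤ w.length * (K + 1) / n := by
  have hn' : (0 : ℝ) < n := by exact_mod_cast hn
  induction w with
  | nil =>
    intro D σ p q hpq _ _
    simp [firstMerge, hpq, condMean_const]
  | cons c w ih =>
    have exposed : ∀ (D : Finset (Fin n × Bool)) (σ : Fin n × Bool → Fin n) (p q : Fin n),
        p ≠ q → q ∉ D.image Prod.fst → (p, c) ∈ D → D.card + 1 + 2 * w.length ≤ K →
        condMean D σ (firstMerge (c :: w) p q) ≤ (w.length + 1) * (K + 1) / n := by
      intro D σ p q hpq hq hp hK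
      have hqD : (q, c) ∉ D := fun h => hq (Finset.mem_image_of_mem _ h)
      set S := insert (σ (p, c)) ((insert (q, c) D).image Prod.fst) with hS
      have hcard : S.card ≤ K + 1 := by
        refine (Finset.card_insert_le _ _).trans ?_
        have := (Finset.card_image_le (s := insert (q, c) D) (f := Prod.fst)).trans
          (Finset.card_insert_le _ _)
        omega
      rw [condMean_congr (F' := fun δ => firstMerge w (σ (p, c)) (δ (q, c)) δ)
        (fun δ hδ => by simp [firstMerge, hpq, hδ _ hp])]
      refine (condMean_expose_le hqD (H := firstMerge w (σ (p, c)))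
        (b := fun v => (w.length : ℝ) * (K + 1) / n + if v ∈ S then 1 else 0)
        fun v σ' => ?_).trans ?_
      · by_cases hv : v ∈ S
        · rw [if_pos hv]
          have := condMean_le_of_le (D := insert (q, c) D) (σ := σ')
            (firstMerge_le_one w (σ (p, c)) v)
          have : (0 : ℝ) ≤ w.length * (K + 1) / n := by positivity
          linarith
        · rw [if_neg hv, add_zero]
          rw [hS, Finset.mem_insert, not_or] at hv
          refine ih _ _ _ _ (Ne.symm hv.1) hv.2 ?_
          rw [Finset.card_insert_of_notMem hqD]
          exact hK
      · rw [Finset.sum_add_distrib, sum_mem_indicator]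
        have : (S.card : ℝ) ≤ K + 1 := by exact_mod_cast hcard
        simp only [Finset.sum_const, Finset.card_univ, Fintype.card_fin, nsmul_eq_mul]
        rw [div_le_div_iff_of_pos_right hn']
        field_simp
        linarith
    intro D σ p q hpq hq hK
    rw [List.length_cons] at hK ⊢
    push_cast
    by_cases hp : (p, c) ∈ D
    · exact exposed D σ p q hpq hq hp (by omega)
    · refine (condMean_expose_le hp (H := fun _ => firstMerge (c :: w) p q)
        (b := fun _ => (w.length + 1) * (K + 1) / n) fun v σ' => ?_).trans_eq ?_
      · refine exposed _ _ _ _ hpq ?_ (Finset.mem_insert_self _ _) ?_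
        · simpa [hpq.symm] using hq
        · rw [Finset.card_insert_of_notMem hp]
          omega
      · simp
        field_simp

/-- If both transitions by the first letter are fresh, the probability of merging exactly at the
end of the word is at most `1 / n` up to lower order terms. -/
lemma condMean_firstMerge_le (hn : 0 < n) {K : ℕ} (c : Bool) (w : List Bool) :
    ∀ (D : Finset (Fin n × Bool)) (σ : Fin n × Bool → Fin n) (p q : Fin n), p ≠ q →
      (p, c) ∉ D → (q, c) ∉ D → D.card + 2 * (w.length + 1) ≤ K →
      condMean D σ (firstMerge (c :: w) p q) ≤ 1 / n + w.length * (5 * K ^ 3 / n ^ 2) := by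
  have hn' : (0 : ℝ) < n := by exact_mod_cast hn
  have hstep : ∀ (c : Bool) (w : List Bool) (p q : Fin n), p ≠ q →
      firstMerge (c :: w) p q = fun δ => firstMerge w (δ (p, c)) (δ (q, c)) δ := by
    intro c w p q hpq
    ext δ
    simp [firstMerge, hpq]
  induction w generalizing c with
  | nil =>
    intro D σ p q hpq hp hq _
    rw [hstep _ _ _ _ hpq]
    refine (condMean_expose_pair_le hp hq (by simpa using hpq) (H := firstMerge [])
      (b := fun v₁ v₂ => if v₁ = v₂ then 1 else 0) fun v₁ v₂ σ' => ?_).trans_eq ?_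
    · simp only [firstMerge]
      exact (condMean_const _ _ _).le
    · simp
      field_simp
  | cons d w ih =>
    intro D σ p q hpq hp hq hK
    rw [List.length_cons] at hK ⊢
    rw [hstep _ _ _ _ hpq]
    set D' := insert (q, c) (insert (p, c) D) with hD'
    set S := D'.image Prod.fst with hS
    have hD'card : D'.card = D.card + 2 := by
      rw [hD', Finset.card_insert_of_notMem (by simp [hq, hpq.symm]),
        Finset.card_insert_of_notMem hp]
    have hScard : S.card ≤ K := Finset.card_image_le.trans (by omega)
    have hSle : (S.card : ℝ) ≤ K := by exact_mod_cast hScard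
    have hK1 : (1 : ℝ) ≤ K := by exact_mod_cast (by omega : 1 ≤ K)
    have hKw : ((w.length : ℝ) + 1) ≤ K := by exact_mod_cast (by omega : w.length + 1 ≤ K)
    set A : ℝ := 1 / n + w.length * (5 * K ^ 3 / n ^ 2) with hA
    set B : ℝ := K * (K + 1) / n with hB
    have hA0 : 0 ≤ A := by positivity
    have hB0 : 0 ≤ B := by positivity
    have fresh : ∀ (p q : Fin n) σ', p ≠ q → q ∉ S →
        condMean D' σ' (firstMerge (d :: w) p q) ≤ B := by
      intro p q σ' hpq hq
      refine (condMean_firstMerge_le_of_fresh hn (K := K) _ _ _ _ _ hpq hq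
        (by rw [List.length_cons]; omega)).trans ?_
      rw [List.length_cons, hB]
      push_cast
      gcongr
    refine (condMean_expose_pair_le hp hq (by simpa using hpq) (H := firstMerge (d :: w))
      (b := fun v₁ v₂ => A + (if v₁ ∈ S then 1 else 0) * B + (if v₂ ∈ S then 1 else 0) * B
        + (if v₁ ∈ S then 1 else 0) * (if v₂ ∈ S then 1 else 0))
        fun v₁ v₂ σ' => ?_).trans ?_
    · rw [← hD']
      by_cases hv : v₁ = v₂
      · have : firstMerge (d :: w) v₁ v₂ = fun _ => 0 := by
          ext δ
          simp [firstMerge, hv]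
        rw [this, condMean_const]
        positivity
      by_cases h₁ : v₁ ∈ S <;> by_cases h₂ : v₂ ∈ S <;>
        simp only [h₁, h₂, if_true, if_false, zero_mul, mul_zero, one_mul, add_zero]
      · have := condMean_le_of_le (D := D') (σ := σ') (firstMerge_le_one (d :: w) v₁ v₂)
        linarith
      · linarith [fresh v₁ v₂ σ' hv h₂]
      · rw [condMean_congr (F' := firstMerge (d :: w) v₂ v₁)
          (fun δ _ => firstMerge_comm _ _ _ _)]
        linarith [fresh v₂ v₁ σ' (Ne.symm hv) h₁]
      · refine ih d D' σ' v₁ v₂ hv ?_ ?_ (by omega)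
        · exact fun h => h₁ (Finset.mem_image_of_mem _ h)
        · exact fun h => h₂ (Finset.mem_image_of_mem _ h)
    · simp only [Finset.sum_add_distrib, ← Finset.sum_mul, ← Finset.mul_sum, sum_mem_indicator,
        Finset.sum_const, Finset.card_univ, Fintype.card_fin, nsmul_eq_mul]
      rw [div_le_iff₀ (by positivity)]
      have e1 : (1 / (n : ℝ) + ((w.length + 1 : ℕ) : ℝ) * (5 * K ^ 3 / n ^ 2)) * n ^ 2
          = n * (n * A) + 5 * K ^ 3 := by
        rw [hA]
        push_cast
        field_simp
        ring
      have e2 : (n : ℝ) * B = K * (K + 1) := by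
        rw [hB]
        field_simp
      rw [e1]
      have b1 : (S.card : ℝ) * (n * B) ≤ K * (K * (K + 1)) := by
        rw [e2]
        gcongr
      have b2 : (S.card : ℝ) * S.card ≤ K * K := by gcongr
      nlinarith [mul_nonneg (sq_nonneg (K : ℝ)) (sub_nonneg.2 hK1)]

/-- Exposing a simple merge costs a factor `1 / n` and leaves protected transitions fresh. -/
lemma condMean_simpleMerge_mul_le (hn : 0 < n) {K : ℕ} {B : ℝ}
    {F : (Fin n × Bool → Fin n) → ℝ} {A : Set (Fin n × Bool)}
    (hF : ∀ D σ, (∀ e ∈ A, e ∉ D) → D.card ≤ K → condMean D σ F ≤ B) (hB : 0 ≤ B)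
    (c : Bool) (w : List Bool) :
    ∀ (D : Finset (Fin n × Bool)) (σ : Fin n × Bool → Fin n) (U : Finset (Fin n)) (p q : Fin n),
      p ≠ q → p ∉ U → q ∉ U → (∀ e ∈ D, e.1 ∈ U) → D.card + 2 * (w.length + 1) ≤ K →
      (∀ e ∈ A, e ∉ D ∧ e ≠ (p, c) ∧ e ≠ (q, c) ∧ e.1 ∈ insert p (insert q U)) →
      condMean D σ (fun δ => simpleMerge U (c :: w) p q δ * F δ) ≤ B / n := by
  have hn' : (0 : ℝ) < n := by exact_mod_cast hn
  induction w generalizing c with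
  | nil =>
    intro D σ U p q hpq hp hq hD hK hA
    have hpD : (p, c) ∉ D := fun h => hp (hD _ h)
    have hqD : (q, c) ∉ D := fun h => hq (hD _ h)
    rw [condMean_congr (F' := fun δ => (if δ (p, c) = δ (q, c) then 1 else 0) * F δ)
      (fun δ _ => by simp [simpleMerge, hpq, hp, hq])]
    refine (condMean_expose_pair_le hpD hqD (by simpa using hpq)
      (H := fun v₁ v₂ δ => (if v₁ = v₂ then 1 else 0) * F δ)
      (b := fun v₁ v₂ => (if v₁ = v₂ then 1 else 0) * B) fun v₁ v₂ σ' => ?_).trans_eq ?_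
    · rw [condMean_const_mul]
      gcongr
      refine hF _ _ (fun e he => ?_) ?_
      · obtain ⟨h1, h2, h3, -⟩ := hA e he
        simp [h1, h2, h3]
      · have := Finset.card_insert_le (q, c) (insert (p, c) D)
        have := Finset.card_insert_le (p, c) D
        simp at hK
        omega
    · simp
      field_simp
  | cons d w ih =>
    intro D σ U p q hpq hp hq hD hK hA
    have hpD : (p, c) ∉ D := fun h => hp (hD _ h)
    have hqD : (q, c) ∉ D := fun h => hq (hD _ h)
    set U' := insert p (insert q U) with hU'
    rw [condMean_congr
      (F' := fun δ => simpleMerge U' (d :: w) (δ (p, c)) (δ (q, c)) δ * F δ)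
      (fun δ _ => by simp [simpleMerge, hpq, hp, hq, hU'])]
    refine (condMean_expose_pair_le hpD hqD (by simpa using hpq)
      (H := fun v₁ v₂ δ => simpleMerge U' (d :: w) v₁ v₂ δ * F δ)
      (b := fun _ _ => B / n) fun v₁ v₂ σ' => ?_).trans_eq ?_
    · by_cases hv : v₁ ≠ v₂ ∧ v₁ ∉ U' ∧ v₂ ∉ U'
      · refine ih d _ _ _ _ _ hv.1 hv.2.1 hv.2.2 ?_ ?_ ?_
        · intro e he
          simp only [Finset.mem_insert] at he
          rcases he with rfl | rfl | he
          · simp [hU']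
          · simp [hU']
          · simp [hU', hD e he]
        · rw [Finset.card_insert_of_notMem (by simp [hqD, hpq.symm]),
            Finset.card_insert_of_notMem hpD]
          rw [List.length_cons] at hK
          omega
        · intro e he
          obtain ⟨h1, h2, h3, h4⟩ := hA e he
          refine ⟨by simp [h1, h2, h3], ?_, ?_, by simp only [Finset.mem_insert, h4, or_true]⟩
          · rintro rfl
            exact hv.2.1 h4
          · rintro rfl
            exact hv.2.2 h4
      · rw [condMean_congr (F' := fun _ => 0) (fun δ _ => by rw [simpleMerge, if_neg hv, zero_mul]),
          condMean_const]
        positivity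
    · simp
      field_simp

lemma condMean_simpleMerge_le (hn : 0 < n) (c : Bool) (w : List Bool)
    (σ : Fin n × Bool → Fin n) {p q : Fin n} (hpq : p ≠ q) :
    condMean ∅ σ (simpleMerge ∅ (c :: w) p q) ≤ 1 / n := by
  have := condMean_simpleMerge_mul_le hn (K := 2 * (w.length + 1)) (F := fun _ => 1) (A := ∅)
    (fun D σ _ _ => (condMean_const D σ 1).le) zero_le_one c w ∅ σ ∅ p q hpq
    (by simp) (by simp) (by simp) (by simp) (by simp)
  simpa using this

/-- Simple merges along two distinct words of equal length are asymptotically uncorrelated. -/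
lemma condMean_simpleMerge_mul_firstMerge_le (hn : 0 < n) {K : ℕ} (w w' : List Bool)
    (hlen : w.length = w'.length) (hne : w ≠ w') :
    ∀ (D : Finset (Fin n × Bool)) (σ : Fin n × Bool → Fin n) (U : Finset (Fin n)) (p q : Fin n),
      p ≠ q → p ∉ U → q ∉ U → (∀ e ∈ D, e.1 ∈ U) → D.card + 4 * w.length ≤ K →
      condMean D σ (fun δ => simpleMerge U w p q δ * firstMerge w' p q δ) ≤
        (1 / n + 5 * K ^ 4 / n ^ 2) / n := by
  have hn' : (0 : ℝ) < n := by exact_mod_cast hn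
  induction w generalizing w' with
  | nil => exact absurd (List.length_eq_zero_iff.1 hlen.symm).symm hne
  | cons c w ih =>
    obtain _ | ⟨c', w'⟩ := w'
    · simp at hlen
    intro D σ U p q hpq hp hq hD hK
    have hpD : (p, c) ∉ D := fun h => hp (hD _ h)
    have hqD : (q, c) ∉ D := fun h => hq (hD _ h)
    have hlen' : w.length = w'.length := by simpa using hlen
    rw [List.length_cons] at hK
    by_cases hc : c = c'
    · subst hc
      have hww : w ≠ w' := fun h => hne (by rw [h])
      set U' := insert p (insert q U) with hU'
      rw [condMean_congr (F' := fun δ => simpleMerge U' w (δ (p, c)) (δ (q, c)) δ *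
          firstMerge w' (δ (p, c)) (δ (q, c)) δ)
        (fun δ _ => by simp [simpleMerge, firstMerge, hpq, hp, hq, hU'])]
      refine (condMean_expose_pair_le hpD hqD (by simpa using hpq)
        (H := fun v₁ v₂ δ => simpleMerge U' w v₁ v₂ δ * firstMerge w' v₁ v₂ δ)
        (b := fun _ _ => (1 / n + 5 * K ^ 4 / n ^ 2) / n) fun v₁ v₂ σ' => ?_).trans_eq ?_
      · by_cases hv : v₁ ≠ v₂ ∧ v₁ ∉ U' ∧ v₂ ∉ U'
        · refine ih w' hlen' hww _ _ _ _ _ hv.1 hv.2.1 hv.2.2 ?_ ?_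
          · intro e he
            simp only [Finset.mem_insert] at he
            rcases he with rfl | rfl | he
            · simp [hU']
            · simp [hU']
            · simp [hU', hD e he]
          · rw [Finset.card_insert_of_notMem (by simp [hqD, hpq.symm]),
              Finset.card_insert_of_notMem hpD]
            omega
        · obtain _ | ⟨d, w⟩ := w
          · exact absurd (List.length_eq_zero_iff.1 hlen'.symm).symm hww
          rw [condMean_congr (F' := fun _ => 0)
            (fun δ _ => by rw [simpleMerge, if_neg hv, zero_mul]), condMean_const]
          positivity
      · simp
        field_simp
    · refine condMean_simpleMerge_mul_le hn (K := D.card + 2 * (w.length + 1))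
        (A := {(p, c'), (q, c')}) (fun D' σ' hA hD' => ?_) (by positivity) c w D σ U p q hpq
        hp hq hD le_rfl ?_
      · refine (condMean_firstMerge_le hn (K := K) c' w' D' σ' p q hpq (hA _ (by simp))
          (hA _ (by simp)) (by omega)).trans ?_
        have : (w'.length : ℝ) ≤ K := by exact_mod_cast (by omega : w'.length ≤ K)
        calc (1 / n + w'.length * (5 * K ^ 3 / n ^ 2) : ℝ)
            ≤ 1 / n + K * (5 * K ^ 3 / n ^ 2) := by gcongr
          _ = _ := by ring
      · have hc' : c' ≠ c := Ne.symm hc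
        have hp' : (p, c') ∉ D := fun h => hp (hD _ h)
        have hq' : (q, c') ∉ D := fun h => hq (hD _ h)
        simp [hc', hp', hq']

lemma le_condMean_simpleMerge (hn : 0 < n) {K : ℕ} (c : Bool) (w : List Bool) :
    ∀ (D : Finset (Fin n × Bool)) (σ : Fin n × Bool → Fin n) (U : Finset (Fin n)) (p q : Fin n),
      p ≠ q → p ∉ U → q ∉ U → (∀ e ∈ D, e.1 ∈ U) → U.card + 2 * (w.length + 1) ≤ K →
      (1 / n - w.length * (2 * K + 1) / n ^ 2 : ℝ) ≤
        condMean D σ (simpleMerge U (c :: w) p q) := by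
  have hn' : (0 : ℝ) < n := by exact_mod_cast hn
  induction w generalizing c with
  | nil =>
    intro D σ U p q hpq hp hq hD hK
    have hpD : (p, c) ∉ D := fun h => hp (hD _ h)
    have hqD : (q, c) ∉ D := fun h => hq (hD _ h)
    rw [condMean_congr (F' := fun δ => if δ (p, c) = δ (q, c) then 1 else 0)
      (fun δ _ => by simp [simpleMerge, hpq, hp, hq])]
    refine le_of_eq_of_le ?_ (le_condMean_expose_pair hpD hqD (by simpa using hpq)
      (H := fun v₁ v₂ _ => if v₁ = v₂ then 1 else 0)
      (b := fun v₁ v₂ => if v₁ = v₂ then 1 else 0) fun v₁ v₂ σ' => ?_)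
    · simp
      field_simp
    · exact (condMean_const _ _ _).ge
  | cons d w ih =>
    intro D σ U p q hpq hp hq hD hK
    have hpD : (p, c) ∉ D := fun h => hp (hD _ h)
    have hqD : (q, c) ∉ D := fun h => hq (hD _ h)
    rw [List.length_cons] at hK ⊢
    set U' := insert p (insert q U) with hU'
    have hUcard : U'.card ≤ U.card + 2 :=
      (Finset.card_insert_le _ _).trans (Nat.succ_le_succ (Finset.card_insert_le _ _))
    have hUle : (U'.card : ℝ) ≤ K := by exact_mod_cast (by omega : U'.card ≤ K)
    rw [condMean_congr (F' := fun δ => simpleMerge U' (d :: w) (δ (p, c)) (δ (q, c)) δ)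
      (fun δ _ => by simp [simpleMerge, hpq, hp, hq, hU'])]
    refine le_trans ?_ (le_condMean_expose_pair hpD hqD (by simpa using hpq)
      (H := simpleMerge U' (d :: w))
      (b := fun v₁ v₂ => (1 / n - w.length * (2 * K + 1) / n ^ 2) -
        1 / n * (if v₁ ∈ U' then 1 else 0) - 1 / n * (if v₂ ∈ U' then 1 else 0) -
        1 / n * (if v₁ = v₂ then 1 else 0)) fun v₁ v₂ σ' => ?_)
    · simp only [Finset.sum_sub_distrib, ← Finset.mul_sum, sum_mem_indicator,
        Finset.sum_const, Finset.card_univ, Fintype.card_fin, nsmul_eq_mul, Finset.sum_ite_eq,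
        Finset.mem_univ, if_true, mul_one]
      rw [le_div_iff₀ (by positivity)]
      push_cast
      field_simp
      nlinarith
    · by_cases hv : v₁ ≠ v₂ ∧ v₁ ∉ U' ∧ v₂ ∉ U'
      · simp only [hv.1, hv.2.1, hv.2.2, if_false, mul_zero, sub_zero]
        refine ih d _ _ _ _ _ hv.1 hv.2.1 hv.2.2 ?_ (by omega)
        intro e he
        simp only [Finset.mem_insert] at he
        rcases he with rfl | rfl | he
        · simp [hU']
        · simp [hU']
        · simp [hU', hD e he]
      · have h0 : 0 ≤ condMean (insert (q, c) (insert (p, c) D)) σ'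
            (simpleMerge U' (d :: w) v₁ v₂) :=
          le_condMean_of_le fun δ => simpleMerge_nonneg _ _ _ _ _
        refine le_trans ?_ h0
        have h1 : (0 : ℝ) ≤ w.length * (2 * K + 1) / n ^ 2 := by positivity
        have h2 : (0 : ℝ) ≤ 1 / n := by positivity
        by_cases ha : v₁ = v₂ <;> by_cases hb : v₁ ∈ U' <;> by_cases hc : v₂ ∈ U' <;>
          simp only [ha, hb, hc, if_true, if_false] <;> first | linarith | tauto

end Merging

/-- Second moment bound for the number of words of length `k` along which `x` and `y` merge. -/
lemma condMean_forall_run_ne_le {n k : ℕ} (hk : 0 < k) (σ : Fin n × Bool → Fin n)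
    {x y : Fin n} (hxy : x ≠ y) :
    condMean ∅ σ (fun δ => if ∀ w : List Bool, w.length = k → run δ w x ≠ run δ w y
      then 1 else 0) ≤ 5 * (4 * k) ^ 4 / n + 2 * k * (8 * k + 1) / n + n / 2 ^ k := by
  have hn : 0 < n := x.pos
  have hn' : (0 : ℝ) < n := by exact_mod_cast hn
  set W : Finset (List Bool) := Finset.univ.image (List.ofFn (n := k)) with hW
  have hlen : ∀ w ∈ W, w.length = k := by
    intro w hw
    obtain ⟨f, -, rfl⟩ := Finset.mem_image.1 hw
    simp
  have hcard : W.card = 2 ^ k := by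
    rw [hW, Finset.card_image_of_injective _ List.ofFn_injective]
    simp
  have hcons : ∀ w ∈ W, ∃ c v, w = c :: v ∧ v.length + 1 = k := by
    intro w hw
    have := hlen w hw
    obtain _ | ⟨c, v⟩ := w
    · simp at this
      omega
    · exact ⟨c, v, rfl, by simpa using this⟩
  set s : List Bool → (Fin n × Bool → Fin n) → ℝ := fun w => simpleMerge ∅ w x y
  set μ : ℝ := 2 ^ k / n with hμ
  have hμ0 : 0 < μ := by positivity
  set η : ℝ := 5 * (4 * k) ^ 4 / n ^ 2 with hη
  have hη0 : 0 ≤ η := by positivity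
  have first : μ * (1 - k * (8 * k + 1) / n) ≤ condMean ∅ σ (fun δ => ∑ w ∈ W, s w δ) := by
    rw [condMean_sum]
    have : ∀ w ∈ W, (1 / n - k * (8 * k + 1) / n ^ 2 : ℝ) ≤ condMean ∅ σ (s w) := by
      intro w hw
      obtain ⟨c, v, rfl, hv⟩ := hcons w hw
      refine le_trans ?_ (le_condMean_simpleMerge hn (K := 4 * k) c v ∅ σ ∅ x y hxy
        (by simp) (by simp) (by simp) (by simp; omega))
      have : (v.length : ℝ) ≤ k := by exact_mod_cast (by omega : v.length ≤ k)
      push_cast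
      rw [show (8 * k + 1 : ℝ) = 2 * (4 * k) + 1 by ring]
      gcongr
    refine le_trans (le_of_eq ?_) (Finset.card_nsmul_le_sum _ _ _ this)
    rw [hcard, nsmul_eq_mul, hμ]
    push_cast
    field_simp
  have second : condMean ∅ σ (fun δ => (∑ w ∈ W, s w δ) * ∑ w ∈ W, s w δ) ≤
      μ ^ 2 * (1 + n * η) + μ := by
    simp only [Finset.sum_mul_sum, condMean_sum]
    have : ∀ w ∈ W, ∀ w' ∈ W, condMean ∅ σ (fun δ => s w δ * s w' δ) ≤
        (1 / n + η) / n + if w = w' then 1 / (n : ℝ) else 0 := by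
      intro w hw w' hw'
      by_cases hww : w = w'
      · subst hww
        obtain ⟨c, v, rfl, -⟩ := hcons w hw
        rw [if_pos rfl, condMean_congr (F' := s (c :: v))
          (fun δ _ => simpleMerge_mul_self _ _ _ _ _)]
        have := condMean_simpleMerge_le hn c v σ hxy
        have : 0 ≤ (1 / n + η) / n := by positivity
        linarith
      · rw [if_neg hww, add_zero]
        have hl := hlen w hw
        have := condMean_simpleMerge_mul_firstMerge_le hn (K := 4 * k) w w'
          (hl.trans (hlen w' hw').symm) hww ∅ σ ∅ x y hxy (by simp) (by simp) (by simp)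
          (by simp [hl])
        push_cast at this
        refine le_trans (condMean_mono fun δ _ => ?_) this
        exact mul_le_mul_of_nonneg_left (simpleMerge_le_firstMerge _ _ _ _ _)
          (simpleMerge_nonneg _ _ _ _ _)
    refine (Finset.sum_le_sum fun w hw => Finset.sum_le_sum fun w' hw' =>
      this w hw w' hw').trans_eq ?_
    have hdiag : ∑ w ∈ W, ∑ w' ∈ W, (if w = w' then 1 / (n : ℝ) else 0) = μ := by
      rw [Finset.sum_congr rfl (g := fun _ => 1 / (n : ℝ)) fun w hw => by
        rw [Finset.sum_ite_eq, if_pos hw]]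
      simp [hcard, hμ, div_eq_mul_inv]
    simp only [Finset.sum_add_distrib, hdiag, Finset.sum_const, hcard, nsmul_eq_mul]
    rw [hμ]
    push_cast
    field_simp
  have chebyshev : μ ^ 2 * condMean ∅ σ (fun δ =>
      if ∀ w : List Bool, w.length = k → run δ w x ≠ run δ w y then 1 else 0) ≤
      condMean ∅ σ (fun δ => ((∑ w ∈ W, s w δ) * ∑ w ∈ W, s w δ) + μ ^ 2
        - 2 * μ * ∑ w ∈ W, s w δ) := by
    rw [← condMean_const_mul]
    refine condMean_mono fun δ _ => ?_
    split_ifs with h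
    · have : ∑ w ∈ W, s w δ = 0 :=
        Finset.sum_eq_zero fun w hw => simpleMerge_eq_zero_of_run_ne (h w (hlen w hw))
      simp [this]
    · nlinarith [sq_nonneg (∑ w ∈ W, s w δ - μ)]
  rw [condMean_sub, condMean_add, condMean_const, condMean_const_mul] at chebyshev
  have hfinal : μ ^ 2 * condMean ∅ σ (fun δ =>
      if ∀ w : List Bool, w.length = k → run δ w x ≠ run δ w y then 1 else 0) ≤
      μ ^ 2 * (n * η + 2 * k * (8 * k + 1) / n + 1 / μ) := by
    have h1 := mul_le_mul_of_nonneg_left first (by positivity : 0 ≤ 2 * μ)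
    have e : μ ^ 2 * (n * η + 2 * k * (8 * k + 1) / n + 1 / μ) =
        μ ^ 2 * (1 + n * η) + μ + μ ^ 2 - 2 * μ * (μ * (1 - k * (8 * k + 1) / n)) := by
      field_simp
      ring
    rw [e]
    linarith
  refine (le_of_mul_le_mul_left hfinal (by positivity)).trans_eq ?_
  rw [hη, hμ, one_div_div]
  field_simp

lemma tendsto_natLog_sq_pow_div :
    Filter.Tendsto (fun n : ℕ => 1300 * ((Nat.log 2 (n ^ 2) : ℝ) + 1) ^ 4 / n)
      Filter.atTop (nhds 0) := by
  have hlim : Filter.Tendsto (fun n : ℕ => 1300 * 5 ^ 4 * (Real.log n ^ 4 / (n : ℝ)))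
      Filter.atTop (nhds 0) := by
    have h := (Real.isLittleO_pow_log_id_atTop (n := 4)).tendsto_div_nhds_zero.comp
      tendsto_natCast_atTop_atTop
    simpa using h.const_mul (1300 * 5 ^ 4 : ℝ)
  refine squeeze_zero' (Filter.Eventually.of_forall fun n => by positivity) ?_ hlim
  filter_upwards [Filter.eventually_ge_atTop 3] with n hn
  have hn' : (3 : ℝ) ≤ n := by exact_mod_cast hn
  have hlog : 1 ≤ Real.log n := by
    rw [Real.le_log_iff_exp_le (by linarith)]
    linarith [Real.exp_one_lt_d9]
  have hk : (Nat.log 2 (n ^ 2) : ℝ) * Real.log 2 ≤ 2 * Real.log n := by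
    have h := Real.log_le_log (by positivity)
      (show ((2 : ℝ) ^ Nat.log 2 (n ^ 2)) ≤ (n : ℝ) ^ 2 by
        exact_mod_cast Nat.pow_log_le_self 2 (by positivity))
    rw [Real.log_pow, Real.log_pow] at h
    exact_mod_cast h
  have hle : (Nat.log 2 (n ^ 2) : ℝ) + 1 ≤ 5 * Real.log n := by
    nlinarith [Real.log_two_gt_d9, Nat.cast_nonneg (α := ℝ) (Nat.log 2 (n ^ 2))]
  calc 1300 * ((Nat.log 2 (n ^ 2) : ℝ) + 1) ^ 4 / n
      ≤ 1300 * (5 * Real.log n) ^ 4 / n := by gcongr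
    _ = _ := by ring

/-- For a uniformly random automaton, for every pair of distinct
states `x ≠ y`, the probability that no word of length at most `2·log₂ n`
synchronizes `x` and `y` (i.e. that `d(x,y) > 2·log₂ n`) tends to `0`,
uniformly over the pair. -/
theorem pair_distance_le_whp_uniform :
    ∀ ε : ℝ, 0 < ε → ∃ N : ℕ, ∀ n : ℕ, N ≤ n → ∀ x y : Fin n, x ≠ y →
      ((Finset.univ.filter (fun δ : Fin n × Bool → Fin n =>
          ¬ ∃ ω : List Bool,
              (ω.length : ℝ) ≤ 2 * Real.logb 2 n ∧
                run δ ω x = run δ ω y)).card : ℝ)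
        / (n : ℝ) ^ (2 * n) ≤ ε := by
  intro ε hε
  obtain ⟨N, hN⟩ := Filter.eventually_atTop.1
    (tendsto_natLog_sq_pow_div.eventually (ge_mem_nhds hε))
  refine ⟨max N 2, fun n hn x y hxy => ?_⟩
  refine le_trans ?_ (hN n (le_of_max_le_left hn))
  have hn2 : 2 ≤ n := le_of_max_le_right hn
  have hn' : (0 : ℝ) < n := by positivity
  set k := Nat.log 2 (n ^ 2) with hk
  have hk0 : 0 < k := Nat.log_pos (by norm_num) (by nlinarith)
  have hklog : (k : ℝ) ≤ 2 * Real.logb 2 n := by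
    have h := Real.natLog_le_logb (n ^ 2) 2
    push_cast at h
    rwa [Real.logb_pow, Nat.cast_ofNat] at h
  have hpow : (n : ℝ) / 2 ^ k ≤ 2 / n := by
    have h : n ^ 2 ≤ 2 ^ k * 2 := by
      rw [← pow_succ]
      exact (Nat.lt_pow_succ_log_self (by norm_num) _).le
    rw [div_le_div_iff₀ (by positivity) hn']
    have : (n : ℝ) ^ 2 ≤ 2 ^ k * 2 := by exact_mod_cast h
    nlinarith
  have hmean := condMean_forall_run_ne_le hk0 (fun e => e.1) hxy
  rw [condMean_empty, ← Finset.natCast_card_filter] at hmean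
  have hcard : (Fintype.card (Fin n × Bool → Fin n) : ℝ) = (n : ℝ) ^ (2 * n) := by
    simp [mul_comm]
  rw [hcard] at hmean
  calc _ ≤ _ := by
        gcongr with δ
        intro h w hw heq
        exact h ⟨w, by rwa [hw], heq⟩
    _ ≤ _ := hmean
    _ ≤ 5 * (4 * k) ^ 4 / n + 2 * k * (8 * k + 1) / n + 2 / n := by gcongr
    _ = (1280 * k ^ 4 + 2 * k * (8 * k + 1) + 2) / n := by ring
    _ ≤ _ := by
        have : (0 : ℝ) ≤ k := by positivity
        gcongr
        nlinarith [pow_nonneg this 2, pow_nonneg this 3, pow_nonneg this 4]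
end
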